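/- arXiv:1207.6460 — 2 statements merged into one kernel-verified Lean document; each statement's English description precedes it below -/
import Mathlib

section
/- Let d ∈ ℕ be squarefree, k = ℚ(i√d), F a quaternion algebra over ℚ, and M = k ⊗_ℚ F. A quaternion algebra E over ℚ embeds into M (as ℚ-algebra) if and only if Σ_k(E) = Σ_k(F). -/
open scoped Quaternion Classical Polynomial TensorProduct

/-- The Hilbert equation `a x² + b y² = 1` has a solution over `R`.
For nonzero rationals `a`, `b` and `R` a completion of `ℚ` this says that the
Hilbert symbol `(a,b)` is `+1`, equivalently that the quaternion algebra
`ℍ[R,a,b]` splits. -/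
def HilbertOne (R : Type*) [CommRing R] [Algebra ℚ R] (a b : ℚ) : Prop :=
  ∃ x y : R, (algebraMap ℚ R a) * x ^ 2 + (algebraMap ℚ R b) * y ^ 2 = 1

/-- Places of `ℚ`: the primes together with the infinite place. -/
inductive QPlace : Type
  | fin : (p : ℕ) → p.Prime → QPlace
  | inf : QPlace

/-- The Hilbert equation has a solution in the completion of `ℚ` at the place `v`. -/
def QPlace.Hone : QPlace → ℚ → ℚ → Prop
  | .fin p hp, a, b => letI : Fact p.Prime := ⟨hp⟩; HilbertOne ℚ_[p] a b
  | .inf, a, b => HilbertOne ℝ a b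

/-- The Hilbert symbol `(a,b)_v ∈ {±1}` at a place `v` of `ℚ`. -/
noncomputable def QPlace.sym (v : QPlace) (a b : ℚ) : ℤ :=
  if v.Hone a b then 1 else -1

/-- A prime `p` splits in `k = ℚ(√-d)` iff `-d` is a square in `ℚ_p`. -/
def SplitsInK (d : ℕ) (p : ℕ) (hp : p.Prime) : Prop :=
  letI : Fact p.Prime := ⟨hp⟩
  ∃ x : ℚ_[p], x ^ 2 = (-(d : ℚ_[p]))

/-- A place of `ℚ` splits in `k = ℚ(√-d)` (the infinite place never splits). -/
def QPlace.SplitsK (v : QPlace) (d : ℕ) : Prop :=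
  match v with
  | .fin p hp => SplitsInK d p hp
  | .inf => False

/-- `Σ_k(F)` for `F = ℍ[ℚ,a,b]` and `k = ℚ(√-d)`: a squarefree natural number whose
prime divisors are exactly the finite ramification primes of `F` that split in `k`. -/
def IsSigmaK (d : ℕ) (a b : ℚ) (sk : ℕ) : Prop :=
  Squarefree sk ∧ ∀ (p : ℕ) (hp : p.Prime),
    (p ∣ sk ↔ (¬ (letI : Fact p.Prime := ⟨hp⟩; HilbertOne ℚ_[p] a b) ∧ SplitsInK d p hp))

/-- `Σ(F)` for `F = ℍ[ℚ,a,b]`: the signed squarefree integer whose prime divisors are the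
finite ramification primes of `F`, and which is negative iff `F` ramifies at `∞`. -/
def IsSigma (a b : ℚ) (sf : ℤ) : Prop :=
  Squarefree sf ∧
    (∀ (p : ℕ) (hp : p.Prime),
      ((p : ℤ) ∣ sf ↔ ¬ (letI : Fact p.Prime := ⟨hp⟩; HilbertOne ℚ_[p] a b))) ∧
    (sf < 0 ↔ ¬ HilbertOne ℝ a b)

/-- The field `k = ℚ(i√d)`, realized as `ℚ[X]/(X² + d)`. -/
noncomputable abbrev Qk (d : ℕ) : Type :=
  AdjoinRoot ((Polynomial.X : ℚ[X]) ^ 2 + Polynomial.C (d : ℚ))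

/-- The element `i√d` of `k`. -/
noncomputable def QkRoot (d : ℕ) : Qk d := AdjoinRoot.root _

/-- The part of the integer `n` prime to `p`. -/
def unitPart (p : ℕ) (n : ℤ) : ℤ := n / (p : ℤ) ^ padicValInt p n

/-- The explicit formula for the Hilbert symbol of `p ^ m * u` and `p ^ n * v` at the prime `p`,
where `u` and `v` are prime to `p`. -/
noncomputable def hilbertFormula (p m : ℕ) (u : ℤ) (n : ℕ) (v : ℤ) : ℤ :=
  if p = 2 then
    (if u % 4 = 3 ∧ v % 4 = 3 then -1 else 1) * ZMod.χ₈ (u : ZMod 8) ^ n * ZMod.χ₈ (v : ZMod 8) ^ m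
  else jacobiSym (-1) p ^ (m * n) * jacobiSym u p ^ n * jacobiSym v p ^ m

/-- The Hilbert symbol of two nonzero integers at the prime `p`, given by an explicit formula. -/
noncomputable def hilbertSym (p : ℕ) (a b : ℤ) : ℤ :=
  hilbertFormula p (padicValInt p a) (unitPart p a) (padicValInt p b) (unitPart p b)

section HilbertSymbol

variable {p : ℕ}

lemma exists_eq_pow_mul (hp : p.Prime) {n : ℤ} (hn : n ≠ 0) :
    ∃ (m : ℕ) (u : ℤ), ¬ (p : ℤ) ∣ u ∧ n = (p : ℤ) ^ m * u := by
  have hfin : FiniteMultiplicity (p : ℤ) n :=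
    Int.finiteMultiplicity_iff.2 ⟨by simpa using hp.ne_one, hn⟩
  obtain ⟨u, hu, hnd⟩ := hfin.exists_eq_pow_mul_and_not_dvd
  exact ⟨_, u, hnd, hu⟩

lemma ne_zero_of_not_dvd {u : ℤ} (hu : ¬ (p : ℤ) ∣ u) : u ≠ 0 := by
  rintro rfl; exact hu (dvd_zero _)

lemma padicValInt_pow_mul (hp : p.Prime) {u : ℤ} (hu : ¬ (p : ℤ) ∣ u) (m : ℕ) :
    padicValInt p ((p : ℤ) ^ m * u) = m := by
  have : Fact p.Prime := ⟨hp⟩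
  have hp0 : (p : ℤ) ≠ 0 := by exact_mod_cast hp.ne_zero
  rw [padicValInt.of_ne_one_ne_zero hp.ne_one (mul_ne_zero (pow_ne_zero _ hp0)
    (ne_zero_of_not_dvd hu))]
  exact multiplicity_eq_of_dvd_of_not_dvd (dvd_mul_right _ _)
    (by rw [pow_succ, mul_dvd_mul_iff_left (pow_ne_zero _ hp0)]; exact hu)

lemma hilbertSym_pow_mul (hp : p.Prime) {u v : ℤ} (hu : ¬ (p : ℤ) ∣ u) (hv : ¬ (p : ℤ) ∣ v)
    (m n : ℕ) :
    hilbertSym p ((p : ℤ) ^ m * u) ((p : ℤ) ^ n * v) = hilbertFormula p m u n v := by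
  have hp0 : (p : ℤ) ≠ 0 := by exact_mod_cast hp.ne_zero
  rw [hilbertSym, unitPart, unitPart, padicValInt_pow_mul hp hu, padicValInt_pow_mul hp hv,
    Int.mul_ediv_cancel_left _ (pow_ne_zero _ hp0), Int.mul_ediv_cancel_left _ (pow_ne_zero _ hp0)]

lemma hilbertSym_units (hp : p.Prime) {u v : ℤ} (hu : ¬ (p : ℤ) ∣ u) (hv : ¬ (p : ℤ) ∣ v) :
    hilbertSym p u v = hilbertFormula p 0 u 0 v := by
  simpa using hilbertSym_pow_mul hp hu hv 0 0

lemma isUnit_jacobiSym (hp : p.Prime) {u : ℤ} (hu : ¬ (p : ℤ) ∣ u) : IsUnit (jacobiSym u p) := by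
  rw [Int.isUnit_iff]
  refine jacobiSym.eq_one_or_neg_one ?_
  have := (Nat.Prime.coprime_iff_not_dvd hp).2 (fun h => hu (Int.natCast_dvd.2 h))
  rw [Int.gcd_comm]; exact this

lemma isUnit_chi_eight {u : ℤ} (hu : ¬ (2 : ℤ) ∣ u) : IsUnit (ZMod.χ₈ (u : ZMod 8)) := by
  rw [ZMod.χ₈_int_eq_if_mod_eight, if_neg (by omega), Int.isUnit_iff]
  split_ifs <;> simp

lemma isUnit_hilbertFormula (hp : p.Prime) {u v : ℤ} (hu : ¬ (p : ℤ) ∣ u) (hv : ¬ (p : ℤ) ∣ v)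
    (m n : ℕ) : IsUnit (hilbertFormula p m u n v) := by
  unfold hilbertFormula
  split_ifs with h2 h
  · subst h2
    exact (isUnit_one.neg.mul ((isUnit_chi_eight hu).pow _)).mul ((isUnit_chi_eight hv).pow _)
  · subst h2
    exact (isUnit_one.mul ((isUnit_chi_eight hu).pow _)).mul ((isUnit_chi_eight hv).pow _)
  · exact (((isUnit_jacobiSym hp (by
      rw [dvd_neg]; exact_mod_cast hp.one_lt.ne' ∘ Nat.dvd_one.1)).pow _).mul
      ((isUnit_jacobiSym hp hu).pow _)).mul ((isUnit_jacobiSym hp hv).pow _)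

lemma hilbertSym_eq_one_or (hp : p.Prime) {a b : ℤ} (ha : a ≠ 0) (hb : b ≠ 0) :
    hilbertSym p a b = 1 ∨ hilbertSym p a b = -1 := by
  obtain ⟨m, u, hu, rfl⟩ := exists_eq_pow_mul hp ha
  obtain ⟨n, v, hv, rfl⟩ := exists_eq_pow_mul hp hb
  rw [hilbertSym_pow_mul hp hu hv, ← Int.isUnit_iff]
  exact isUnit_hilbertFormula hp hu hv m n

lemma hilbertSym_mul_self (hp : p.Prime) {a b : ℤ} (ha : a ≠ 0) (hb : b ≠ 0) :
    hilbertSym p a b * hilbertSym p a b = 1 := by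
  rcases hilbertSym_eq_one_or hp ha hb with h | h <;> simp [h]

lemma hilbertSym_comm (a b : ℤ) : hilbertSym p a b = hilbertSym p b a := by
  simp only [hilbertSym, hilbertFormula, and_comm (a := unitPart p a % 4 = 3),
    mul_comm (padicValInt p a)]
  split_ifs <;> ring

lemma hilbertFormula_mul (hp : p.Prime) {u v w : ℤ} (hv : ¬ (p : ℤ) ∣ v) (hw : ¬ (p : ℤ) ∣ w)
    (m n l : ℕ) : hilbertFormula p m u (n + l) (v * w) =
      hilbertFormula p m u n v * hilbertFormula p m u l w := by
  unfold hilbertFormula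
  by_cases h2 : p = 2
  · subst h2
    simp only [if_true, Int.cast_mul, map_mul]
    have hvw : (v * w) % 4 = (v % 4) * (w % 4) % 4 := Int.mul_emod _ _ _
    have key : (if u % 4 = 3 ∧ (v * w) % 4 = 3 then (-1 : ℤ) else 1) =
        (if u % 4 = 3 ∧ v % 4 = 3 then -1 else 1) * (if u % 4 = 3 ∧ w % 4 = 3 then -1 else 1) := by
      rw [hvw]
      have h1 : v % 4 = 1 ∨ v % 4 = 3 := by push_cast at hv; omega
      have h2 : w % 4 = 1 ∨ w % 4 = 3 := by push_cast at hw; omega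
      rcases h1 with h1 | h1 <;> rcases h2 with h2 | h2 <;> rw [h1, h2] <;> split_ifs <;> simp_all
    rw [key]; ring
  · simp only [if_neg h2, jacobiSym.mul_left]; ring

lemma not_dvd_mul (hp : p.Prime) {v w : ℤ} (hv : ¬ (p : ℤ) ∣ v) (hw : ¬ (p : ℤ) ∣ w) :
    ¬ (p : ℤ) ∣ v * w := fun h =>
  ((Nat.prime_iff_prime_int.1 hp).dvd_or_dvd h).elim hv hw

lemma hilbertSym_mul_right (hp : p.Prime) {a b c : ℤ} (ha : a ≠ 0) (hb : b ≠ 0) (hc : c ≠ 0) :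
    hilbertSym p a (b * c) = hilbertSym p a b * hilbertSym p a c := by
  obtain ⟨m, u, hu, rfl⟩ := exists_eq_pow_mul hp ha
  obtain ⟨n, v, hv, rfl⟩ := exists_eq_pow_mul hp hb
  obtain ⟨l, w, hw, rfl⟩ := exists_eq_pow_mul hp hc
  rw [hilbertSym_pow_mul hp hu hv, hilbertSym_pow_mul hp hu hw, ← hilbertFormula_mul hp hv hw,
    ← hilbertSym_pow_mul hp hu (not_dvd_mul hp hv hw), pow_add]
  congr 1; ring

lemma hilbertSym_mul_sq_right (hp : p.Prime) {a b c : ℤ} (ha : a ≠ 0) (hb : b ≠ 0) (hc : c ≠ 0) :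
    hilbertSym p a (b * c ^ 2) = hilbertSym p a b := by
  rw [hilbertSym_mul_right hp ha hb (pow_ne_zero _ hc), sq, hilbertSym_mul_right hp ha hc hc,
    hilbertSym_mul_self hp ha hc, mul_one]

lemma hilbertSym_one_right (hp : p.Prime) {a : ℤ} (ha : a ≠ 0) : hilbertSym p a 1 = 1 := by
  have := hilbertSym_mul_sq_right hp ha one_ne_zero one_ne_zero
  have h2 := hilbertSym_mul_right hp ha one_ne_zero one_ne_zero
  rw [mul_one] at h2
  rcases hilbertSym_eq_one_or hp ha one_ne_zero with h | h <;> rw [h] at h2 ⊢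
  norm_num at h2

lemma hilbertSym_neg_self (hp : p.Prime) {a : ℤ} (ha : a ≠ 0) : hilbertSym p a (-a) = 1 := by
  obtain ⟨m, u, hu, rfl⟩ := exists_eq_pow_mul hp ha
  have hu' : ¬ (p : ℤ) ∣ -u := by rwa [dvd_neg]
  rw [← mul_neg, hilbertSym_pow_mul hp hu hu', hilbertFormula]
  split_ifs with h2 h
  · omega
  · subst h2
    rw [one_mul, ← mul_pow, ← map_mul]
    have h1 : u % 8 = 1 ∨ u % 8 = 3 ∨ u % 8 = 5 ∨ u % 8 = 7 := by push_cast at hu; omega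
    rw [← Int.cast_mul, ZMod.χ₈_int_eq_if_mod_eight]
    have : (u * -u) % 8 = 7 := by
      rw [Int.mul_emod, Int.neg_emod]
      rcases h1 with h1 | h1 | h1 | h1 <;> simp [h1] <;> omega
    rw [if_neg (by omega), if_pos (by omega), one_pow]
  · rw [neg_eq_neg_one_mul u, jacobiSym.mul_left]
    have h1 : IsUnit (jacobiSym (-1) p) := isUnit_jacobiSym hp (by
      rw [dvd_neg]; exact_mod_cast hp.one_lt.ne' ∘ Nat.dvd_one.1)
    rcases Int.isUnit_iff.1 h1 with h | h <;>
    rcases Int.isUnit_iff.1 (isUnit_jacobiSym hp hu) with h' | h' <;> rw [h, h'] <;>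
    simp [← pow_add]
    · exact Even.neg_one_pow (by rw [← Nat.mul_succ]; exact Nat.even_mul_succ_self m)
    · exact Even.neg_one_pow (by rw [← Nat.mul_succ]; exact Nat.even_mul_succ_self m)

lemma hilbertSym_congr (hp : p.Prime) {x v w : ℤ} (hx : x ≠ 0) (hv : ¬ (p : ℤ) ∣ v) (n : ℕ)
    (hvw : v ≡ w [ZMOD (p : ℤ) ^ 3]) :
    hilbertSym p x ((p : ℤ) ^ n * v) = hilbertSym p x ((p : ℤ) ^ n * w) := by
  have hw : ¬ (p : ℤ) ∣ w := by
    rwa [← (hvw.of_dvd (dvd_pow_self _ three_ne_zero)).dvd_iff]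
  obtain ⟨m, u, hu, rfl⟩ := exists_eq_pow_mul hp hx
  rw [hilbertSym_pow_mul hp hu hv, hilbertSym_pow_mul hp hu hw, hilbertFormula, hilbertFormula]
  by_cases h2 : p = 2
  · subst h2
    have h8 : v % 8 = w % 8 := by simpa [Int.ModEq] using hvw
    have h4 : v % 4 = w % 4 := by omega
    simp only [if_true, h4, (ZMod.intCast_eq_intCast_iff' v w 8).2 (by exact_mod_cast h8)]
  · simp only [if_neg h2]
    rw [jacobiSym.mod_left' (a₁ := v) (a₂ := w) (hvw.of_dvd (dvd_pow_self _ three_ne_zero))]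

lemma hilbertSym_eq_one_of_not_dvd (hp : p.Prime) (h2 : p ≠ 2) {u v : ℤ} (hu : ¬ (p : ℤ) ∣ u)
    (hv : ¬ (p : ℤ) ∣ v) : hilbertSym p u v = 1 := by
  simp [hilbertSym_units hp hu hv, hilbertFormula, h2]

end HilbertSymbol

section ProductFormula

lemma intCast_induction (Q : ℤ → Prop) (S : Finset ℕ) (one : Q 1) (neg_one : Q (-1))
    (prime : ∀ p ∈ S, Q p) (mul : ∀ a b, a ≠ 0 → b ≠ 0 → Q a → Q b → Q (a * b)) {a : ℤ}
    (ha : a ≠ 0) (hS : ∀ p : ℕ, p.Prime → (p : ℤ) ∣ a → p ∈ S) : Q a := by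
  have key : ∀ n : ℕ, n ≠ 0 → (∀ p : ℕ, p.Prime → p ∣ n → p ∈ S) → Q n := by
    intro n
    induction n using Nat.recOnMul with
    | zero => intro h; exact absurd rfl h
    | one => intro _ _; exact_mod_cast one
    | prime p hp => intro _ h; exact prime p (h p hp dvd_rfl)
    | mul m n hm hn =>
      intro h hS
      have h' := mul_ne_zero_iff.1 h
      rw [Nat.cast_mul]
      exact mul _ _ (by exact_mod_cast h'.1) (by exact_mod_cast h'.2)
        (hm h'.1 fun p hp hd => hS p hp (hd.mul_right _))
        (hn h'.2 fun p hp hd => hS p hp (hd.mul_left _))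
  have hn := key a.natAbs (Int.natAbs_ne_zero.2 ha)
    fun p hp hd => hS p hp (Int.natCast_dvd.2 hd)
  rcases Int.natAbs_eq a with h | h
  · rw [h]; exact hn
  · rw [h, neg_eq_neg_one_mul]
    exact mul _ _ (by norm_num) (by simpa using ha) neg_one hn

lemma not_dvd_neg_one {p : ℕ} (hp : p.Prime) : ¬ (p : ℤ) ∣ -1 := by
  rw [dvd_neg]; exact_mod_cast hp.one_lt.ne' ∘ Nat.dvd_one.1

lemma not_dvd_prime {p q : ℕ} (hp : p.Prime) (hq : q.Prime) (h : p ≠ q) : ¬ (p : ℤ) ∣ q :=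
  fun hd => h ((Nat.prime_dvd_prime_iff_eq hp hq).1 (by exact_mod_cast hd))

lemma hilbertSym_prime_right {p : ℕ} (hp : p.Prime) (h2 : p ≠ 2) {u : ℤ} (hu : ¬ (p : ℤ) ∣ u) :
    hilbertSym p u p = jacobiSym u p := by
  have := hilbertSym_pow_mul hp hu (not_dvd_neg_one hp ∘ dvd_neg.2) 0 1
  simpa [hilbertFormula, h2] using this

lemma hilbertSym_two_right {u : ℤ} (hu : ¬ (2 : ℤ) ∣ u) :
    hilbertSym 2 u 2 = ZMod.χ₈ (u : ZMod 8) := by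
  have := hilbertSym_pow_mul Nat.prime_two (p := 2) hu
    (not_dvd_neg_one Nat.prime_two ∘ dvd_neg.2) 0 1
  simpa [hilbertFormula] using this

lemma hilbertSym_two_units {u v : ℤ} (hu : ¬ (2 : ℤ) ∣ u) (hv : ¬ (2 : ℤ) ∣ v) :
    hilbertSym 2 u v = if u % 4 = 3 ∧ v % 4 = 3 then -1 else 1 := by
  simp [hilbertSym_units Nat.prime_two hu hv, hilbertFormula]

lemma sign_mul_right {a b c : ℤ} (hb : b ≠ 0) (hc : c ≠ 0) :
    (if a < 0 ∧ b * c < 0 then (-1 : ℤ) else 1) =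
      (if a < 0 ∧ b < 0 then -1 else 1) * (if a < 0 ∧ c < 0 then -1 else 1) := by
  rcases lt_or_gt_of_ne hb with h | h <;> rcases lt_or_gt_of_ne hc with h' | h' <;>
    by_cases h0 : a < 0 <;> simp [h0, h, h', mul_pos_of_neg_of_neg, mul_neg_of_pos_of_neg,
      mul_neg_of_neg_of_pos, not_lt_of_gt]

variable {S : Finset ℕ}

lemma prod_hilbertSym_mul_right (hS : ∀ p ∈ S, p.Prime) {a b c : ℤ} (ha : a ≠ 0) (hb : b ≠ 0)
    (hc : c ≠ 0) : ∏ p ∈ S, hilbertSym p a (b * c) =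
      (∏ p ∈ S, hilbertSym p a b) * ∏ p ∈ S, hilbertSym p a c := by
  rw [← Finset.prod_mul_distrib]
  exact Finset.prod_congr rfl fun p hp => hilbertSym_mul_right (hS p hp) ha hb hc

lemma prod_hilbertSym_neg_one_neg_one (hS : ∀ p ∈ S, p.Prime) (h2 : 2 ∈ S) :
    ∏ p ∈ S, hilbertSym p (-1) (-1) = -1 := by
  rw [Finset.prod_eq_single_of_mem 2 h2]
  · rw [hilbertSym_two_units (by norm_num) (by norm_num)]; norm_num
  · intro p hp hne
    exact hilbertSym_eq_one_of_not_dvd (hS p hp) hne (not_dvd_neg_one (hS p hp))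
      (not_dvd_neg_one (hS p hp))

/-- The product formula for `-1` or `2` and an odd prime. -/
lemma prod_hilbertSym_unit_prime (hS : ∀ p ∈ S, p.Prime) (h2 : 2 ∈ S) {u : ℤ}
    (hu : ∀ p : ℕ, p.Prime → p ≠ 2 → ¬ (p : ℤ) ∣ u) {l : ℕ} (hl : l ∈ S) (hl2 : l ≠ 2) :
    ∏ p ∈ S, hilbertSym p u l = hilbertSym 2 u l * jacobiSym u l := by
  rw [Finset.prod_eq_mul_of_mem 2 l h2 hl hl2.symm,
    hilbertSym_prime_right (hS l hl) hl2 (hu l (hS l hl) hl2)]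
  rintro p hp ⟨hp2, hpl⟩
  exact hilbertSym_eq_one_of_not_dvd (hS p hp) hp2 (hu p (hS p hp) hp2)
    (not_dvd_prime (hS p hp) (hS l hl) hpl)

lemma prod_hilbertSym_neg_one_prime (hS : ∀ p ∈ S, p.Prime) (h2 : 2 ∈ S) {l : ℕ} (hl : l ∈ S) :
    ∏ p ∈ S, hilbertSym p (-1) l = 1 := by
  by_cases hl2 : l = 2
  · subst hl2
    refine Finset.prod_eq_one fun p hp => ?_
    by_cases hp2 : p = 2
    · subst hp2
      rw [Nat.cast_ofNat, hilbertSym_two_right (by norm_num)]; decide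
    · exact hilbertSym_eq_one_of_not_dvd (hS p hp) hp2 (not_dvd_neg_one (hS p hp))
        (not_dvd_prime (hS p hp) Nat.prime_two hp2)
  · have hodd : Odd l := (hS l hl).odd_of_ne_two hl2
    have hodd' := Nat.odd_iff.1 hodd
    rw [prod_hilbertSym_unit_prime hS h2 (fun p hp _ => not_dvd_neg_one hp) hl hl2,
      hilbertSym_two_units (by norm_num) (by omega), jacobiSym.at_neg_one hodd,
      ZMod.χ₄_nat_eq_if_mod_four]
    have : l % 4 = 1 ∨ l % 4 = 3 := by omega
    rcases this with h | h
    · rw [if_neg (by omega), if_neg (by omega), if_pos h]; rfl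
    · rw [if_pos (by omega), if_neg (by omega), if_neg (by omega)]; rfl

lemma prod_hilbertSym_prime_prime (hS : ∀ p ∈ S, p.Prime) (h2 : 2 ∈ S) {l q : ℕ} (hl : l ∈ S)
    (hq : q ∈ S) : ∏ p ∈ S, hilbertSym p l q = 1 := by
  have hl0 : (l : ℤ) ≠ 0 := by exact_mod_cast (hS l hl).ne_zero
  have two : ∀ r ∈ S, r ≠ 2 → ∏ p ∈ S, hilbertSym p 2 r = 1 := by
    intro r hr hr2
    have hodd : Odd r := (hS r hr).odd_of_ne_two hr2
    have hodd' := Nat.odd_iff.1 hodd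
    rw [prod_hilbertSym_unit_prime hS h2 (u := 2) (fun p hp hp2 => by
      exact_mod_cast not_dvd_prime hp Nat.prime_two hp2) hr hr2, hilbertSym_comm,
      hilbertSym_two_right (by omega), jacobiSym.at_two hodd, Int.cast_natCast]
    rcases Int.isUnit_iff.1 (isUnit_chi_eight (u := r) (by omega)) with h | h <;>
      rw [Int.cast_natCast] at h <;> rw [h] <;> rfl
  by_cases hlq : l = q
  · subst hlq
    have h := prod_hilbertSym_mul_right hS hl0 (neg_ne_zero.2 hl0) (neg_ne_zero.2 one_ne_zero)
    rw [show -(l : ℤ) * -1 = l by ring] at h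
    rw [h, Finset.prod_congr rfl fun p _ => hilbertSym_comm (p := p) (l : ℤ) (-1),
      prod_hilbertSym_neg_one_prime hS h2 hl,
      Finset.prod_congr rfl fun p hp => hilbertSym_neg_self (hS p hp) hl0]
    simp
  by_cases hl2 : l = 2
  · subst hl2; exact two q hq (Ne.symm hlq)
  by_cases hq2 : q = 2
  · subst hq2
    rw [Finset.prod_congr rfl fun p _ => hilbertSym_comm (p := p) _ _]
    exact two l hl hlq
  have hlo : Odd l := (hS l hl).odd_of_ne_two hl2
  have hqo : Odd q := (hS q hq).odd_of_ne_two hq2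
  have hlo' := Nat.odd_iff.1 hlo
  have hqo' := Nat.odd_iff.1 hqo
  have hsub : ({2, l, q} : Finset ℕ) ⊆ S := by
    intro x hx; simp only [Finset.mem_insert, Finset.mem_singleton] at hx
    rcases hx with rfl | rfl | rfl <;> assumption
  rw [← Finset.prod_subset hsub, Finset.prod_insert (by simp [Ne.symm hl2, Ne.symm hq2]),
    Finset.prod_pair hlq, hilbertSym_two_units (by omega) (by omega),
    hilbertSym_prime_right (hS q hq) hq2 (not_dvd_prime (hS q hq) (hS l hl) (Ne.symm hlq)),
    hilbertSym_comm (p := l),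
    hilbertSym_prime_right (hS l hl) hl2 (not_dvd_prime (hS l hl) (hS q hq) hlq),
    jacobiSym.quadratic_reciprocity hlo hqo, pow_mul]
  · have hj : jacobiSym q l * jacobiSym q l = 1 := by
      rcases Int.isUnit_iff.1 (isUnit_jacobiSym (hS l hl)
        (not_dvd_prime (hS l hl) (hS q hq) hlq)) with h | h <;> rw [h] <;> rfl
    have h1 : l % 4 = 1 ∨ l % 4 = 3 := by omega
    have h2 : q % 4 = 1 ∨ q % 4 = 3 := by omega
    have sgn : ∀ n : ℕ, (n % 4 = 1 → (-1 : ℤ) ^ (n / 2) = 1) ∧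
        (n % 4 = 3 → (-1 : ℤ) ^ (n / 2) = -1) := fun n =>
      ⟨fun h => Even.neg_one_pow (Nat.even_iff.2 (by omega)),
        fun h => Odd.neg_one_pow (Nat.odd_iff.2 (by omega))⟩
    rcases h1 with h1 | h1
    · rw [(sgn l).1 h1, one_pow, if_neg (by omega)]; linear_combination hj
    · rw [(sgn l).2 h1]
      rcases h2 with h2 | h2
      · rw [(sgn q).1 h2, if_neg (by omega)]; linear_combination hj
      · rw [(sgn q).2 h2, if_pos (by omega)]; linear_combination hj
  · intro p hp hx
    simp only [Finset.mem_insert, Finset.mem_singleton, not_or] at hx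
    exact hilbertSym_eq_one_of_not_dvd (hS p hp) hx.1 (not_dvd_prime (hS p hp) (hS l hl) hx.2.1)
      (not_dvd_prime (hS p hp) (hS q hq) hx.2.2)

/-- The product formula for the Hilbert symbol over `ℚ`. -/
theorem prod_hilbertSym (hS : ∀ p ∈ S, p.Prime) (h2 : 2 ∈ S) {a b : ℤ} (ha : a ≠ 0) (hb : b ≠ 0)
    (haS : ∀ p : ℕ, p.Prime → (p : ℤ) ∣ a → p ∈ S)
    (hbS : ∀ p : ℕ, p.Prime → (p : ℤ) ∣ b → p ∈ S) :
    ∏ p ∈ S, hilbertSym p a b = if a < 0 ∧ b < 0 then -1 else 1 := by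
  have comm : ∀ x y : ℤ, ∏ p ∈ S, hilbertSym p x y = ∏ p ∈ S, hilbertSym p y x := fun x y =>
    Finset.prod_congr rfl fun p _ => hilbertSym_comm x y
  have one : ∀ x : ℤ, x ≠ 0 → ∏ p ∈ S, hilbertSym p x 1 = 1 := fun x hx =>
    Finset.prod_eq_one fun p hp => hilbertSym_one_right (hS p hp) hx
  refine intCast_induction
    (fun a => a ≠ 0 → ∏ p ∈ S, hilbertSym p a b = if a < 0 ∧ b < 0 then -1 else 1) S
    ?_ ?_ ?_ ?_ ha haS ha
  · intro _; rw [comm, one b hb, if_neg (by omega)]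
  · intro _
    refine intCast_induction (fun b => b ≠ 0 →
      ∏ p ∈ S, hilbertSym p (-1) b = if (-1 : ℤ) < 0 ∧ b < 0 then -1 else 1) S
      ?_ ?_ ?_ ?_ hb hbS hb
    · intro _; rw [one _ (by norm_num), if_neg (by omega)]
    · intro _; rw [prod_hilbertSym_neg_one_neg_one hS h2, if_pos (by omega)]
    · intro q hq _; rw [prod_hilbertSym_neg_one_prime hS h2 hq, if_neg (by omega)]
    · intro x y hx hy h h' _
      rw [prod_hilbertSym_mul_right hS (by norm_num) hx hy, h hx, h' hy, ← sign_mul_right hx hy]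
  · intro l hl hl0
    rw [if_neg (by omega)]
    refine intCast_induction (fun b => b ≠ 0 → ∏ p ∈ S, hilbertSym p l b = 1) S
      ?_ ?_ ?_ ?_ hb hbS hb
    · intro _; rw [one _ hl0]
    · intro _; rw [comm, prod_hilbertSym_neg_one_prime hS h2 hl]
    · intro q hq _; exact prod_hilbertSym_prime_prime hS h2 hl hq
    · intro x y hx hy h h' _
      rw [prod_hilbertSym_mul_right hS hl0 hx hy, h hx, h' hy, mul_one]
  · intro x y hx hy h h' _
    rw [comm, prod_hilbertSym_mul_right hS hb hx hy, comm b x, comm b y, h hx, h' hy]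
    simp only [and_comm (b := b < 0)]
    rw [← sign_mul_right hx hy]

end ProductFormula

/-- `b` is of the form `r ^ 2 - a * s ^ 2`, i.e. a norm from `K(√a)`. -/
def IsQuadNorm {K : Type*} [Field K] (a b : K) : Prop := ∃ r s : K, b = r ^ 2 - a * s ^ 2

namespace IsQuadNorm

variable {K : Type*} [Field K] {a b c : K}

lemma mul (hb : IsQuadNorm a b) (hc : IsQuadNorm a c) : IsQuadNorm a (b * c) := by
  obtain ⟨r, s, rfl⟩ := hb
  obtain ⟨t, u, rfl⟩ := hc
  exact ⟨r * t + a * s * u, r * u + s * t, by ring⟩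

lemma sq (a t : K) : IsQuadNorm a (t ^ 2) := ⟨t, 0, by ring⟩

lemma neg_self (a : K) : IsQuadNorm a (-a) := ⟨0, 1, by ring⟩

lemma of_mul_right (hc0 : c ≠ 0) (hc : IsQuadNorm a c) (h : IsQuadNorm a (b * c)) :
    IsQuadNorm a b := by
  obtain ⟨r, s, h⟩ := (h.mul hc).mul (sq a c⁻¹)
  exact ⟨r, s, by rw [← h]; field_simp⟩

lemma mul_right_iff (hc0 : c ≠ 0) (hc : IsQuadNorm a c) :
    IsQuadNorm a (b * c) ↔ IsQuadNorm a b :=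
  ⟨of_mul_right hc0 hc, fun h => h.mul hc⟩

lemma mul_sq_iff {t : K} (ht : t ≠ 0) : IsQuadNorm a (b * t ^ 2) ↔ IsQuadNorm a b :=
  mul_right_iff (pow_ne_zero _ ht) (sq a t)

lemma of_isSquare [NeZero (2 : K)] (ha : a ≠ 0) (h : IsSquare a) (b : K) : IsQuadNorm a b := by
  obtain ⟨t, rfl⟩ := h
  have ht : t ≠ 0 := by rintro rfl; simp at ha
  have h2 : (2 : K) ≠ 0 := two_ne_zero
  exact ⟨(b + 1) / 2, (b - 1) / (2 * t), by field_simp; ring⟩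

lemma iff_exists_eq_one [NeZero (2 : K)] (ha : a ≠ 0) (hb : b ≠ 0) :
    IsQuadNorm a b ↔ ∃ x y : K, a * x ^ 2 + b * y ^ 2 = 1 := by
  constructor
  · rintro ⟨r, s, h⟩
    by_cases hr : r = 0
    · have hba : b = -a * s ^ 2 := by rw [h, hr]; ring
      have hs : s ≠ 0 := by rintro rfl; simp [hba] at hb
      have h2 : (2 : K) ≠ 0 := two_ne_zero
      refine ⟨(a⁻¹ + 1) / 2, (a⁻¹ - 1) / (2 * s), ?_⟩
      rw [hba]; field_simp; ring
    · exact ⟨s / r, 1 / r, by rw [h]; field_simp; ring⟩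
  · rintro ⟨x, y, h⟩
    by_cases hy : y = 0
    · have hx : a * x ^ 2 = 1 := by simpa [hy] using h
      have hx0 : x ≠ 0 := by rintro rfl; simp at hx
      refine of_isSquare ha ⟨x⁻¹, ?_⟩ b
      field_simp; exact hx
    · exact ⟨1 / y, x / y, by field_simp; linear_combination h⟩

lemma comm [NeZero (2 : K)] (ha : a ≠ 0) (hb : b ≠ 0) : IsQuadNorm a b ↔ IsQuadNorm b a := by
  rw [iff_exists_eq_one ha hb, iff_exists_eq_one hb ha, exists_comm]
  simp only [add_comm]

lemma mul_sq_left_iff {t : K} (ht : t ≠ 0) : IsQuadNorm (a * t ^ 2) b ↔ IsQuadNorm a b := by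
  constructor
  · rintro ⟨r, s, h⟩
    exact ⟨r, t * s, by rw [h]; ring⟩
  · rintro ⟨r, s, h⟩
    exact ⟨r, s / t, by rw [h]; field_simp⟩

lemma map {L : Type*} [Field L] (f : K →+* L) (h : IsQuadNorm a b) :
    IsQuadNorm (f a) (f b) := by
  obtain ⟨r, s, rfl⟩ := h
  exact ⟨f r, f s, by simp⟩

end IsQuadNorm

section Local

variable {p : ℕ} [hp : Fact p.Prime]

lemma isSquare_padic {n m : ℤ} (k : ℕ) (h : (p : ℤ) ^ k ∣ m ^ 2 - n)
    (hm : ¬ (p : ℤ) ^ k ∣ 4 * m ^ 2) : IsSquare (n : ℚ_[p]) := by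
  let F : ℤ[X] := Polynomial.X ^ 2 - Polynomial.C n
  have hF : ∀ z : ℤ_[p], Polynomial.aeval z F = z ^ 2 - n := fun z => by simp [F]
  have hF' : ∀ z : ℤ_[p], Polynomial.aeval z (Polynomial.derivative F) = 2 * z := fun z => by
    simp only [F, map_sub, Polynomial.derivative_X_sq, Polynomial.derivative_C, sub_zero, map_mul,
      Polynomial.aeval_X]
    simp [Polynomial.aeval_def]
  have hlt : ‖Polynomial.aeval (m : ℤ_[p]) F‖ <
      ‖Polynomial.aeval (m : ℤ_[p]) (Polynomial.derivative F)‖ ^ 2 := by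
    rw [hF, hF', ← norm_pow]
    have h1 : ((m : ℤ_[p]) ^ 2 - n) = ((m ^ 2 - n : ℤ) : ℤ_[p]) := by push_cast; rfl
    have h2 : (2 * (m : ℤ_[p])) ^ 2 = ((4 * m ^ 2 : ℤ) : ℤ_[p]) := by push_cast; ring
    rw [h1, h2]
    refine lt_of_le_of_lt ((PadicInt.norm_int_le_pow_iff_dvd).2 (by exact_mod_cast h)) ?_
    rw [← not_le, PadicInt.norm_int_le_pow_iff_dvd]
    exact_mod_cast hm
  obtain ⟨z, hz, -⟩ := hensels_lemma hlt
  rw [hF] at hz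
  refine ⟨z, ?_⟩
  have := congrArg (fun x : ℤ_[p] => (x : ℚ_[p])) hz
  push_cast at this
  linear_combination -this

lemma exists_dvd_of_jacobiSym {u : ℤ} (hu : ¬ (p : ℤ) ∣ u) :
    jacobiSym u p = 1 ↔ ∃ m : ℤ, (p : ℤ) ∣ m ^ 2 - u := by
  have hu' : (u : ZMod p) ≠ 0 := by rwa [Ne, ZMod.intCast_zmod_eq_zero_iff_dvd]
  rw [← jacobiSym.legendreSym.to_jacobiSym, legendreSym.eq_one_iff p hu']
  constructor
  · rintro ⟨m, hm⟩
    obtain ⟨m, rfl⟩ := ZMod.intCast_surjective m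
    refine ⟨m, ?_⟩
    rw [← ZMod.intCast_zmod_eq_zero_iff_dvd]
    push_cast; rw [hm]; ring
  · rintro ⟨m, hm⟩
    rw [← ZMod.intCast_zmod_eq_zero_iff_dvd] at hm
    push_cast at hm
    exact ⟨m, by linear_combination -hm⟩

lemma not_dvd_four_mul (h2 : p ≠ 2) {m : ℤ} (hm : ¬ (p : ℤ) ∣ m) : ¬ (p : ℤ) ^ 1 ∣ 4 * m ^ 2 := by
  rw [pow_one, show (4 : ℤ) * m ^ 2 = ((2 : ℕ) * (2 : ℕ)) * (m * m) by push_cast; ring]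
  exact not_dvd_mul hp.out (not_dvd_mul hp.out (not_dvd_prime hp.out Nat.prime_two h2)
    (not_dvd_prime hp.out Nat.prime_two h2)) (not_dvd_mul hp.out hm hm)

lemma isSquare_padic_of_jacobiSym (h2 : p ≠ 2) {u : ℤ} (hu : ¬ (p : ℤ) ∣ u)
    (h : jacobiSym u p = 1) : IsSquare (u : ℚ_[p]) := by
  obtain ⟨m, hm⟩ := (exists_dvd_of_jacobiSym hu).1 h
  refine isSquare_padic 1 (by simpa using hm) (not_dvd_four_mul h2 fun hd => hu ?_)
  have := dvd_sub (hd.mul_left m) hm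
  rwa [show m * m - (m ^ 2 - u) = u by ring] at this

lemma isSquare_padic_two {u : ℤ} (hu : u % 8 = 1) : IsSquare (u : ℚ_[2]) :=
  isSquare_padic (p := 2) (m := 1) 3 (by norm_num; omega) (by norm_num)

/-- A representation as a norm over `ℚ_[p]` gives a primitive solution modulo `p ^ n`. -/
lemma exists_primitive_of_isQuadNorm {a b : ℤ} (h : IsQuadNorm (a : ℚ_[p]) b) (n : ℕ) :
    ∃ R S Z : ℤ, (p : ℤ) ^ n ∣ R ^ 2 - a * S ^ 2 - b * Z ^ 2 ∧ (R = 1 ∨ S = 1 ∨ Z = 1) := by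
  have key : ∃ R S Z : ℤ_[p], R ^ 2 - a * S ^ 2 - b * Z ^ 2 = 0 ∧ (R = 1 ∨ S = 1 ∨ Z = 1) := by
    obtain ⟨r, s, h⟩ := h
    have lift : ∀ R S Z : ℚ_[p], ∀ hR : ‖R‖ ≤ 1, ∀ hS : ‖S‖ ≤ 1, ∀ hZ : ‖Z‖ ≤ 1,
        R ^ 2 - a * S ^ 2 - b * Z ^ 2 = 0 → (R = 1 ∨ S = 1 ∨ Z = 1) →
        ∃ R S Z : ℤ_[p], R ^ 2 - a * S ^ 2 - b * Z ^ 2 = 0 ∧ (R = 1 ∨ S = 1 ∨ Z = 1) := by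
      intro R S Z hR hS hZ h h'
      refine ⟨⟨R, hR⟩, ⟨S, hS⟩, ⟨Z, hZ⟩, ?_, ?_⟩
      · apply Subtype.ext; push_cast; exact h
      · refine h'.imp (fun h => Subtype.ext h) (Or.imp (fun h => Subtype.ext h)
          (fun h => Subtype.ext h))
    by_cases h1 : ‖r‖ ≤ 1 ∧ ‖s‖ ≤ 1
    · exact lift r s 1 h1.1 h1.2 (by simp) (by rw [h]; ring) (by simp)
    by_cases h2 : ‖s‖ ≤ ‖r‖
    · have hr1 : 1 < ‖r‖ := by
        by_contra hc; exact h1 ⟨not_lt.1 hc, h2.trans (not_lt.1 hc)⟩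
      have hr : r ≠ 0 := by rintro rfl; simp at hr1; linarith
      refine lift 1 (s / r) r⁻¹ (by simp) ?_ ?_ (by rw [h]; field_simp; ring) (by simp)
      · rw [norm_div]; exact div_le_one_of_le₀ h2 (norm_nonneg _)
      · rw [norm_inv]; exact inv_le_one_of_one_le₀ hr1.le
    · have hs1 : 1 < ‖s‖ := by
        by_contra hc; exact h1 ⟨(not_le.1 h2).le.trans (not_lt.1 hc), not_lt.1 hc⟩
      have hs : s ≠ 0 := by rintro rfl; simp at hs1; linarith
      refine lift (r / s) 1 s⁻¹ ?_ (by simp) ?_ (by rw [h]; field_simp; ring) (by simp)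
      · rw [norm_div]; exact div_le_one_of_le₀ (not_le.1 h2).le (norm_nonneg _)
      · rw [norm_inv]; exact inv_le_one_of_one_le₀ hs1.le
  obtain ⟨R, S, Z, h, h'⟩ := key
  have lift : ∀ x : ℤ_[p], ∃ m : ℤ, (m : ZMod (p ^ n)) = PadicInt.toZModPow n x ∧
      (x = 1 → m = 1) := by
    intro x
    by_cases hx : x = 1
    · exact ⟨1, by simp [hx], fun _ => rfl⟩
    · obtain ⟨m, hm⟩ := ZMod.intCast_surjective (PadicInt.toZModPow n x)
      exact ⟨m, hm, fun h => absurd h hx⟩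
  obtain ⟨R', hR, hR'⟩ := lift R
  obtain ⟨S', hS, hS'⟩ := lift S
  obtain ⟨Z', hZ, hZ'⟩ := lift Z
  refine ⟨R', S', Z', ?_, h'.imp hR' (Or.imp hS' hZ')⟩
  have := congrArg (PadicInt.toZModPow n) h
  simp only [map_sub, map_mul, map_pow, map_intCast, map_zero] at this
  rw [← hR, ← hS, ← hZ] at this
  have h3 := (ZMod.intCast_zmod_eq_zero_iff_dvd (R' ^ 2 - a * S' ^ 2 - b * Z' ^ 2) (p ^ n)).1
    (by push_cast; exact_mod_cast this)
  exact_mod_cast h3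

end Local

section LocalComparison

variable {p : ℕ} [hp : Fact p.Prime]

lemma isQuadNorm_padic_iff_of_units
    (units : ∀ u v : ℤ, ¬ (p : ℤ) ∣ u → ¬ (p : ℤ) ∣ v →
      (IsQuadNorm (u : ℚ_[p]) (v : ℚ_[p]) ↔ hilbertSym p u v = 1))
    (unif : ∀ u v : ℤ, ¬ (p : ℤ) ∣ u → ¬ (p : ℤ) ∣ v →
      (IsQuadNorm (u : ℚ_[p]) ((p * v : ℤ) : ℚ_[p]) ↔ hilbertSym p u (p * v) = 1))
    {a b : ℤ} (ha : a ≠ 0) (hb : b ≠ 0) :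
    IsQuadNorm (a : ℚ_[p]) (b : ℚ_[p]) ↔ hilbertSym p a b = 1 := by
  have hp0 : (p : ℤ) ≠ 0 := by exact_mod_cast hp.out.ne_zero
  have cast_ne : ∀ {x : ℤ}, x ≠ 0 → (x : ℚ_[p]) ≠ 0 := fun h => by exact_mod_cast h
  have symm : ∀ {x y : ℤ}, x ≠ 0 → y ≠ 0 →
      (IsQuadNorm (x : ℚ_[p]) (y : ℚ_[p]) ↔ hilbertSym p x y = 1) →
      (IsQuadNorm (y : ℚ_[p]) (x : ℚ_[p]) ↔ hilbertSym p y x = 1) := by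
    intro x y hx hy h
    rw [IsQuadNorm.comm (cast_ne hy) (cast_ne hx), h, hilbertSym_comm]
  have sq : ∀ {x y z : ℤ}, x ≠ 0 → y ≠ 0 → z ≠ 0 →
      (IsQuadNorm (x : ℚ_[p]) (y : ℚ_[p]) ↔ hilbertSym p x y = 1) →
      (IsQuadNorm (x : ℚ_[p]) ((y * z ^ 2 : ℤ) : ℚ_[p]) ↔ hilbertSym p x (y * z ^ 2) = 1) := by
    intro x y z hx hy hz h
    rw [hilbertSym_mul_sq_right hp.out hx hy hz, ← h]
    push_cast
    exact IsQuadNorm.mul_sq_iff (cast_ne hz)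
  have red : ∀ (m : ℕ) (u : ℤ),
      (p : ℤ) ^ m * u = ((p : ℤ) ^ (m % 2) * u) * ((p : ℤ) ^ (m / 2)) ^ 2 := by
    intro m u
    conv_lhs => rw [← Nat.mod_add_div m 2, pow_add, pow_mul']
    ring
  obtain ⟨m, u, hu, rfl⟩ := exists_eq_pow_mul hp.out ha
  obtain ⟨n, v, hv, rfl⟩ := exists_eq_pow_mul hp.out hb
  have hu0 := ne_zero_of_not_dvd hu
  have hv0 := ne_zero_of_not_dvd hv
  have hU : ∀ k, (p : ℤ) ^ k * u ≠ 0 := fun k => mul_ne_zero (pow_ne_zero _ hp0) hu0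
  have hV : ∀ k, (p : ℤ) ^ k * v ≠ 0 := fun k => mul_ne_zero (pow_ne_zero _ hp0) hv0
  rw [red n v]
  refine sq (hU _) (hV _) (pow_ne_zero _ hp0) (symm (hV _) (hU _) ?_)
  rw [red m u]
  refine sq (hV _) (hU _) (pow_ne_zero _ hp0) ?_
  rcases Nat.mod_two_eq_zero_or_one m with hm | hm <;>
  rcases Nat.mod_two_eq_zero_or_one n with hn | hn <;>
  simp only [hm, hn, pow_zero, one_mul, pow_one]
  · exact units v u hv hu
  · exact symm hu0 (mul_ne_zero hp0 hv0) (unif u v hu hv)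
  · exact unif v u hv hu
  · have hpu := mul_ne_zero hp0 hu0
    have hpv := mul_ne_zero hp0 hv0
    have hvu : ¬ (p : ℤ) ∣ -(v * u) := by rw [dvd_neg]; exact not_dvd_mul hp.out hv hu
    have h1 := sq hpv (ne_zero_of_not_dvd hvu) hp0 (symm (ne_zero_of_not_dvd hvu) hpv (unif _ v hvu hv))
    rw [show -(v * u) * (p : ℤ) ^ 2 = (p * u) * -(p * v) by ring,
      hilbertSym_mul_right hp.out hpv hpu (neg_ne_zero.2 hpv), hilbertSym_neg_self hp.out hpv,
      mul_one, Int.cast_mul (p * u : ℤ), Int.cast_neg,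
      IsQuadNorm.mul_right_iff (neg_ne_zero.2 (cast_ne hpv)) (IsQuadNorm.neg_self _)] at h1
    exact h1

lemma isQuadNorm_padic_units (h2 : p ≠ 2) {u v : ℤ} (hu : ¬ (p : ℤ) ∣ u) (hv : ¬ (p : ℤ) ∣ v) :
    IsQuadNorm (u : ℚ_[p]) (v : ℚ_[p]) := by
  have hu0 : (u : ℚ_[p]) ≠ 0 := by exact_mod_cast ne_zero_of_not_dvd hu
  have hu' : (u : ZMod p) ≠ 0 := by rwa [Ne, ZMod.intCast_zmod_eq_zero_iff_dvd]
  obtain ⟨r, s, hrs⟩ : ∃ r s : ℤ, (p : ℤ) ∣ r ^ 2 - (v + u * s ^ 2) := by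
    obtain ⟨r, s, h⟩ := FiniteField.exists_root_sum_quadratic (R := ZMod p)
      (f := Polynomial.X ^ 2 - Polynomial.C (v : ZMod p))
      (g := Polynomial.C (-u : ZMod p) * Polynomial.X ^ 2)
      (by compute_degree!) (Polynomial.degree_C_mul_X_pow 2 (neg_ne_zero.2 hu'))
      (by rw [ZMod.card]; exact Nat.odd_iff.1 (hp.out.odd_of_ne_two h2))
    obtain ⟨r, rfl⟩ := ZMod.intCast_surjective r
    obtain ⟨s, rfl⟩ := ZMod.intCast_surjective s
    refine ⟨r, s, ?_⟩
    rw [← ZMod.intCast_zmod_eq_zero_iff_dvd]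
    simp only [Polynomial.eval_sub, Polynomial.eval_pow, Polynomial.eval_X, Polynomial.eval_C,
      Polynomial.eval_mul] at h
    push_cast
    linear_combination h
  by_cases hr : (p : ℤ) ∣ r
  · have hd : (p : ℤ) ∣ v + u * s ^ 2 := by
      have := dvd_sub (hr.mul_left r) hrs
      rwa [show r * r - (r ^ 2 - (v + u * s ^ 2)) = v + u * s ^ 2 by ring] at this
    have hs : ¬ (p : ℤ) ∣ s := fun h => hv <| by
      have := dvd_sub hd (h.mul_left (u * s))
      rwa [show v + u * s ^ 2 - u * s * s = v by ring] at this
    obtain ⟨t, ht⟩ := isSquare_padic (p := p) (n := -(u * v)) (m := u * s) 1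
      (by rw [pow_one, show (u * s) ^ 2 - -(u * v) = u * (v + u * s ^ 2) by ring]
          exact hd.mul_left u)
      (not_dvd_four_mul h2 (not_dvd_mul hp.out hu hs))
    refine ⟨0, t / u, ?_⟩
    push_cast at ht
    field_simp
    linear_combination -ht
  · obtain ⟨t, ht⟩ := isSquare_padic (p := p) (n := v + u * s ^ 2) (m := r) 1
      (by simpa using hrs) (not_dvd_four_mul h2 hr)
    refine ⟨t, s, ?_⟩
    push_cast at ht
    linear_combination ht

lemma jacobiSym_of_isQuadNorm_padic {u v : ℤ} (hu : ¬ (p : ℤ) ∣ u)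
    (hv : ¬ (p : ℤ) ∣ v) (h : IsQuadNorm (u : ℚ_[p]) ((p * v : ℤ) : ℚ_[p])) :
    jacobiSym u p = 1 := by
  have hpi := Nat.prime_iff_prime_int.1 hp.out
  obtain ⟨R, S, Z, hd, h1⟩ := exists_primitive_of_isQuadNorm h 2
  have hd1 : (p : ℤ) ∣ R ^ 2 - u * S ^ 2 := by
    have h3 := (dvd_pow_self (p : ℤ) two_ne_zero).trans hd
    have h4 := dvd_add h3 (Dvd.intro (v * Z ^ 2) rfl : (p : ℤ) ∣ p * (v * Z ^ 2))
    rwa [show R ^ 2 - u * S ^ 2 - p * v * Z ^ 2 + p * (v * Z ^ 2) = R ^ 2 - u * S ^ 2 by ring] at h4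
  by_cases hS : (p : ℤ) ∣ S
  · exfalso
    have hR : (p : ℤ) ∣ R := by
      refine hpi.dvd_of_dvd_pow (n := 2) ?_
      have := dvd_add hd1 (hS.mul_left (u * S))
      rwa [show R ^ 2 - u * S ^ 2 + u * S * S = R ^ 2 by ring] at this
    have hZ : (p : ℤ) ∣ Z := by
      obtain ⟨R', rfl⟩ := hR
      obtain ⟨S', rfl⟩ := hS
      obtain ⟨c, hc⟩ := hd
      have hp0 : (p : ℤ) ≠ 0 := by exact_mod_cast hp.out.ne_zero
      have : v * Z ^ 2 = p * (R' ^ 2 - u * S' ^ 2 - c) := by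
        apply mul_left_cancel₀ hp0
        linear_combination -hc
      exact hpi.dvd_of_dvd_pow ((hpi.dvd_or_dvd (Dvd.intro _ this.symm)).resolve_left hv)
    have hone : ¬ (p : ℤ) ∣ 1 := not_dvd_neg_one hp.out ∘ dvd_neg.2
    rcases h1 with rfl | rfl | rfl
    exacts [hone hR, hone hS, hone hZ]
  · rw [exists_dvd_of_jacobiSym hu]
    have hcop : IsCoprime (p : ℤ) S := (Prime.coprime_iff_not_dvd hpi).2 hS
    obtain ⟨x, y, hxy⟩ := hcop
    refine ⟨R * y, ?_⟩
    obtain ⟨c, hc⟩ := hd1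
    refine ⟨c * y ^ 2 - u * x * (1 + y * S), ?_⟩
    linear_combination y ^ 2 * hc + u * (1 + y * S) * hxy

lemma isQuadNorm_padic_iff_of_odd (h2 : p ≠ 2) {a b : ℤ} (ha : a ≠ 0) (hb : b ≠ 0) :
    IsQuadNorm (a : ℚ_[p]) (b : ℚ_[p]) ↔ hilbertSym p a b = 1 := by
  refine isQuadNorm_padic_iff_of_units ?_ ?_ ha hb
  · intro u v hu hv
    simp only [isQuadNorm_padic_units h2 hu hv, hilbertSym_eq_one_of_not_dvd hp.out h2 hu hv]
  · intro u v hu hv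
    have hsym : hilbertSym p u (p * v) = jacobiSym u p := by
      have := hilbertSym_pow_mul hp.out hu hv 0 1
      simpa [hilbertFormula, h2] using this
    rw [hsym]
    refine ⟨jacobiSym_of_isQuadNorm_padic hu hv, fun h => ?_⟩
    exact IsQuadNorm.of_isSquare (by exact_mod_cast ne_zero_of_not_dvd hu)
      (isSquare_padic_of_jacobiSym h2 hu h) _

lemma isQuadNorm_padic_two_of_mod_eight {u w : ℤ} (k : ℤ) (hu : u ≠ 0) (hw : w ≠ 0)
    (h : (u * (1 - w * k ^ 2)) % 8 = 1) : IsQuadNorm (u : ℚ_[2]) (w : ℚ_[2]) := by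
  obtain ⟨t, ht⟩ := isSquare_padic_two h
  have hu' : (u : ℚ_[2]) ≠ 0 := by exact_mod_cast hu
  rw [IsQuadNorm.iff_exists_eq_one hu' (by exact_mod_cast hw)]
  refine ⟨t / u, k, ?_⟩
  push_cast at ht
  field_simp
  linear_combination -ht

lemma isQuadNorm_padic_two_units {u v : ℤ} (hu : ¬ (2 : ℤ) ∣ u) (hv : ¬ (2 : ℤ) ∣ v) :
    IsQuadNorm (u : ℚ_[2]) (v : ℚ_[2]) ↔ hilbertSym 2 u v = 1 := by
  have hu0 : (u : ℚ_[2]) ≠ 0 := by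
    have : u ≠ 0 := by rintro rfl; simp at hu
    exact_mod_cast this
  have hv0 : (v : ℚ_[2]) ≠ 0 := by
    have : v ≠ 0 := by rintro rfl; simp at hv
    exact_mod_cast this
  have main : ∀ {x y : ℤ}, ¬ (2 : ℤ) ∣ y → x % 4 = 1 → IsQuadNorm (x : ℚ_[2]) (y : ℚ_[2]) := by
    intro x y hy hx
    have h8 : x % 8 = 1 ∨ x % 8 = 5 := by omega
    rcases h8 with h | h
    · exact IsQuadNorm.of_isSquare (by have : x ≠ 0 := by omega
                                       exact_mod_cast this) (isSquare_padic_two h) _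
    · refine isQuadNorm_padic_two_of_mod_eight 2 (by omega) (by omega) ?_
      rw [Int.mul_emod, h, show (1 - y * 2 ^ 2) % 8 = 5 by omega]; norm_num
  rw [hilbertSym_two_units hu hv]
  split_ifs with h
  · simp only [iff_false]
    intro hn
    obtain ⟨R, S, Z, hd, h1⟩ := exists_primitive_of_isQuadNorm hn 2
    have hd' : (4 : ℤ) ∣ R ^ 2 + S ^ 2 + Z ^ 2 := by
      have e1 : (4 : ℤ) ∣ (u + 1) := by omega
      have e2 : (4 : ℤ) ∣ (v + 1) := by omega
      have hd4 : (4 : ℤ) ∣ R ^ 2 - u * S ^ 2 - v * Z ^ 2 := by exact_mod_cast hd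
      have := dvd_add (dvd_add hd4 (e1.mul_right (S ^ 2))) (e2.mul_right (Z ^ 2))
      rwa [show R ^ 2 - u * S ^ 2 - v * Z ^ 2 + (u + 1) * S ^ 2 + (v + 1) * Z ^ 2 =
        R ^ 2 + S ^ 2 + Z ^ 2 by ring] at this
    have sq4 : ∀ x : ℤ, x ^ 2 % 4 = 0 ∨ x ^ 2 % 4 = 1 := by
      intro x
      have h : x % 4 = 0 ∨ x % 4 = 1 ∨ x % 4 = 2 ∨ x % 4 = 3 := by omega
      rw [sq, Int.mul_emod]
      rcases h with h | h | h | h <;> simp [h]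
    have hR := sq4 R
    have hS := sq4 S
    have hZ := sq4 Z
    rcases h1 with rfl | rfl | rfl <;> omega
  · simp only [iff_true]
    by_cases h1 : u % 4 = 1
    · exact main hv h1
    · exact (IsQuadNorm.comm hu0 hv0).2 (main hu (by omega))

lemma sq_sub_mul_sq_ne_zero_zmod_eight : ∀ u v : ZMod 8,
    (u = 5 ∧ (v = 1 ∨ v = 3 ∨ v = 5 ∨ v = 7)) ∨ (u = 3 ∧ (v = 1 ∨ v = 5)) ∨
      (u = 7 ∧ (v = 3 ∨ v = 7)) →
    ∀ R S Z : ZMod 8, (R = 1 ∨ S = 1 ∨ Z = 1) → R ^ 2 - u * S ^ 2 - 2 * v * Z ^ 2 ≠ 0 := by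
  decide +kernel

lemma isQuadNorm_padic_two_unif {u v : ℤ} (hu : ¬ (2 : ℤ) ∣ u) (hv : ¬ (2 : ℤ) ∣ v) :
    IsQuadNorm (u : ℚ_[2]) ((2 * v : ℤ) : ℚ_[2]) ↔ hilbertSym 2 u (2 * v) = 1 := by
  have hsym : hilbertSym 2 u (2 * v) = 1 ↔
      u % 8 = 1 ∨ (u % 8 = 7 ∧ v % 4 = 1) ∨ (u % 8 = 3 ∧ v % 4 = 3) := by
    have := hilbertSym_pow_mul Nat.prime_two (p := 2) hu hv 0 1
    simp only [Nat.cast_ofNat, pow_zero, one_mul, pow_one] at this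
    rw [this, hilbertFormula, if_pos rfl, ZMod.χ₈_int_eq_if_mod_eight]
    have h4 : u % 4 = u % 8 % 4 := by omega
    have h1 : u % 8 = 1 ∨ u % 8 = 3 ∨ u % 8 = 5 ∨ u % 8 = 7 := by omega
    have h2 : v % 4 = 1 ∨ v % 4 = 3 := by omega
    rw [if_neg (show ¬ u % 2 = 0 by omega), h4]
    rcases h1 with h1 | h1 | h1 | h1 <;> rcases h2 with h2 | h2 <;> simp [h1, h2]
  rw [hsym]
  constructor
  · intro h
    by_contra hcon
    have hcases : (u % 8 = 5 ∧ v % 2 = 1) ∨ (u % 8 = 3 ∧ v % 4 = 1) ∨ (u % 8 = 7 ∧ v % 4 = 3) := by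
      omega
    have hv8 : v % 8 = 1 ∨ v % 8 = 3 ∨ v % 8 = 5 ∨ v % 8 = 7 := by omega
    obtain ⟨R, S, Z, hd, h1⟩ := exists_primitive_of_isQuadNorm h 3
    have hd8 : (R : ZMod 8) ^ 2 - u * S ^ 2 - 2 * v * Z ^ 2 = 0 := by
      have := (ZMod.intCast_zmod_eq_zero_iff_dvd (R ^ 2 - u * S ^ 2 - 2 * v * Z ^ 2) 8).2
        (by exact_mod_cast hd)
      exact_mod_cast this
    have h1' : (R : ZMod 8) = 1 ∨ (S : ZMod 8) = 1 ∨ (Z : ZMod 8) = 1 := by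
      rcases h1 with rfl | rfl | rfl <;> simp
    have cast8 : ∀ {x : ℤ} (c : ℤ), x % 8 = c → (x : ZMod 8) = c := fun c hc =>
      by rw [← hc, ZMod.intCast_eq_intCast_iff']; simp
    refine sq_sub_mul_sq_ne_zero_zmod_eight u v ?_ R S Z h1' hd8
    clear hd8 h1' hd h hsym h1 hcon hu hv
    rcases hv8 with h | h | h | h <;> rcases hcases with h' | h' | h' <;>
      first
      | (exfalso; omega)
      | (rw [cast8 (x := v) _ h, cast8 (x := u) _ h'.1]; decide)
  · intro h
    have hu0 : u ≠ 0 := by omega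
    rcases h with h | h | h
    · exact IsQuadNorm.of_isSquare (by exact_mod_cast hu0) (isSquare_padic_two h) _
    · refine isQuadNorm_padic_two_of_mod_eight 1 hu0 (by omega) ?_
      rw [Int.mul_emod, h.1, show (1 - 2 * v * 1 ^ 2) % 8 = 7 by omega]; norm_num
    · refine isQuadNorm_padic_two_of_mod_eight 1 hu0 (by omega) ?_
      rw [Int.mul_emod, h.1, show (1 - 2 * v * 1 ^ 2) % 8 = 3 by omega]; norm_num

/-- The explicit symbol computes the Hilbert symbol of `ℚ_[p]`. -/
theorem isQuadNorm_padic_iff {a b : ℤ} (ha : a ≠ 0) (hb : b ≠ 0) :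
    IsQuadNorm (a : ℚ_[p]) (b : ℚ_[p]) ↔ hilbertSym p a b = 1 := by
  by_cases h2 : p = 2
  · subst h2
    exact isQuadNorm_padic_iff_of_units (fun u v hu hv => isQuadNorm_padic_two_units hu hv)
      (fun u v hu hv => isQuadNorm_padic_two_unif hu hv) ha hb
  · exact isQuadNorm_padic_iff_of_odd h2 ha hb

lemma exists_jacobiSym_eq_neg_one {p : ℕ} (hp : p.Prime) (h2 : p ≠ 2) :
    ∃ w : ℤ, ¬ (p : ℤ) ∣ w ∧ jacobiSym w p = -1 := by
  have : Fact p.Prime := ⟨hp⟩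
  obtain ⟨x, hx⟩ := FiniteField.exists_nonsquare (F := ZMod p) (by rwa [ZMod.ringChar_zmod_n])
  obtain ⟨w, rfl⟩ := ZMod.intCast_surjective x
  have hw : (w : ZMod p) ≠ 0 := by rintro h; rw [h] at hx; exact hx (IsSquare.zero)
  have hw' : ¬ (p : ℤ) ∣ w := by rwa [Ne, ZMod.intCast_zmod_eq_zero_iff_dvd] at hw
  refine ⟨w, hw', (Int.isUnit_iff.1 (isUnit_jacobiSym hp hw')).resolve_left fun h => ?_⟩
  rw [← jacobiSym.legendreSym.to_jacobiSym, legendreSym.eq_one_iff p hw] at h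
  exact hx h

/-- The Hilbert symbol at `p` is nondegenerate. -/
lemma exists_hilbertSym_eq_neg_one {a : ℤ} (ha : a ≠ 0) (h : ¬ IsSquare (a : ℚ_[p])) :
    ∃ z : ℤ, z ≠ 0 ∧ hilbertSym p a z = -1 := by
  have hpp := hp.out
  obtain ⟨m, u, hu, rfl⟩ := exists_eq_pow_mul hpp ha
  have hp0 : (p : ℤ) ≠ 0 := by exact_mod_cast hpp.ne_zero
  have hone : ¬ (p : ℤ) ∣ 1 := not_dvd_neg_one hpp ∘ dvd_neg.2
  have val : ∀ (n : ℕ) (w : ℤ), ¬ (p : ℤ) ∣ w →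
      hilbertSym p ((p : ℤ) ^ m * u) ((p : ℤ) ^ n * w) = hilbertFormula p m u n w :=
    fun n w hw => hilbertSym_pow_mul hpp hu hw m n
  have hsq : Even m → ¬ IsSquare (u : ℚ_[p]) := by
    rintro ⟨k, rfl⟩ ⟨t, ht⟩
    exact h ⟨p ^ k * t, by push_cast; rw [ht]; ring⟩
  by_cases h2 : p = 2
  · subst h2
    rcases Nat.even_or_odd m with hm | hm
    · have hu1 : u % 8 ≠ 1 := fun h1 => hsq hm (isSquare_padic_two h1)
      by_cases hu4 : u % 4 = 3
      · refine ⟨2 ^ 0 * -1, by norm_num, (val 0 (-1) (by norm_num)).trans ?_⟩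
        rw [hilbertFormula, if_pos rfl, if_pos (by omega), ZMod.χ₈_int_eq_if_mod_eight (-1)]
        norm_num
      · refine ⟨2 ^ 1 * 1, by norm_num, (val 1 1 (by norm_num)).trans ?_⟩
        rw [hilbertFormula, if_pos rfl, if_neg (by omega), ZMod.χ₈_int_eq_if_mod_eight,
          if_neg (by push_cast at hu; omega), if_neg (by push_cast at hu; omega)]
        simp
    · refine ⟨2 ^ 0 * 5, by norm_num, (val 0 5 (by norm_num)).trans ?_⟩
      rw [hilbertFormula, if_pos rfl, if_neg (by omega), ZMod.χ₈_int_eq_if_mod_eight 5]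
      norm_num [hm.neg_one_pow]
  · rcases Nat.even_or_odd m with hm | hm
    · refine ⟨p ^ 1 * 1, by simpa using hp0, (val 1 1 hone).trans ?_⟩
      have hj : jacobiSym u p = -1 := (Int.isUnit_iff.1 (isUnit_jacobiSym hpp hu)).resolve_left
        fun hj => hsq hm (isSquare_padic_of_jacobiSym h2 hu hj)
      rw [hilbertFormula, if_neg h2, hj, jacobiSym.one_left]
      rcases Int.isUnit_iff.1 (isUnit_jacobiSym hpp (not_dvd_neg_one hpp)) with h1 | h1 <;>
        rw [h1] <;> simp [hm.neg_one_pow]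
    · obtain ⟨w, hw, hjw⟩ := exists_jacobiSym_eq_neg_one hpp h2
      refine ⟨p ^ 0 * w, by simpa using ne_zero_of_not_dvd hw, (val 0 w hw).trans ?_⟩
      rw [hilbertFormula, if_neg h2, hjw, hm.neg_one_pow]
      simp

end LocalComparison

section Legendre

lemma exists_dvd_sq_sub_of_squarefree {n : ℕ} (hn : Squarefree n) {a : ℤ}
    (h : ∀ p : ℕ, p.Prime → p ∣ n → ∃ t : ℤ, (p : ℤ) ∣ t ^ 2 - a) :
    ∃ t : ℤ, (n : ℤ) ∣ t ^ 2 - a := by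
  induction n using Nat.recOnMul with
  | zero => simp at hn
  | one => simp
  | prime p hp => exact h p hp dvd_rfl
  | mul m n ihm ihn =>
    obtain ⟨t, ht⟩ := ihm hn.of_mul_left fun p hp hd => h p hp (hd.mul_right n)
    obtain ⟨s, hs⟩ := ihn hn.of_mul_right fun p hp hd => h p hp (hd.mul_left m)
    obtain ⟨x, y, hxy⟩ := Nat.isCoprime_iff_coprime.2 (Nat.coprime_of_squarefree_mul hn)
    refine ⟨s * (x * m) + t * (y * n), ?_⟩
    rw [Nat.cast_mul]
    refine IsCoprime.mul_dvd ⟨x, y, hxy⟩ ?_ ?_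
    · obtain ⟨c, hc⟩ := ht
      refine ⟨c + x * (s - t) * (s * (x * m) + t * (y * n) + t), ?_⟩
      linear_combination hc + t * (s * (x * m) + t * (y * n) + t) * hxy
    · obtain ⟨c, hc⟩ := hs
      refine ⟨c + y * (t - s) * (s * (x * m) + t * (y * n) + s), ?_⟩
      linear_combination hc + s * (s * (x * m) + t * (y * n) + s) * hxy

lemma exists_abs_le_dvd_sq_sub {b a t : ℤ} (hb : b ≠ 0) (h : b ∣ t ^ 2 - a) :
    ∃ s : ℤ, b ∣ s ^ 2 - a ∧ 2 * |s| ≤ |b| := by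
  have hpos : 0 < b.natAbs := Int.natAbs_pos.2 hb
  refine ⟨t.bmod b.natAbs, ?_, ?_⟩
  · have h1 : b ∣ t.bmod b.natAbs - t := Int.natAbs_dvd.1 Int.dvd_bmod_sub_self
    have := dvd_add h (h1.mul_right (t.bmod b.natAbs + t))
    rwa [show t ^ 2 - a + (t.bmod b.natAbs - t) * (t.bmod b.natAbs + t) =
      t.bmod b.natAbs ^ 2 - a by ring] at this
  · have h1 := Int.le_bmod (x := t) hpos
    have h2 := Int.bmod_lt (x := t) hpos
    rw [Int.abs_eq_natAbs b]
    rcases abs_cases (t.bmod b.natAbs) with ⟨h, _⟩ | ⟨h, _⟩ <;> rw [h] <;> omega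

/-- The inductive step of Legendre's theorem, for squarefree `b`. -/
lemma exists_descent {a b : ℤ} (ha : a ≠ 0) (hb : Squarefree b) (hab : |a| ≤ |b|) (hb2 : 2 ≤ |b|)
    (h : ∀ p : ℕ, p.Prime → hilbertSym p a b = 1) :
    ∃ t c : ℤ, t ^ 2 - a = b * c ∧ |c| < |b| := by
  have hb0 : b ≠ 0 := hb.ne_zero
  obtain ⟨t, ht⟩ : ∃ t : ℤ, b ∣ t ^ 2 - a := by
    obtain ⟨t, ht⟩ := exists_dvd_sq_sub_of_squarefree (Int.squarefree_natAbs.2 hb) (a := a) (by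
      intro p hp hpb
      have : Fact p.Prime := ⟨hp⟩
      by_cases hpa : (p : ℤ) ∣ a
      · exact ⟨0, by simpa using hpa⟩
      by_cases h2 : p = 2
      · subst h2
        exact ⟨1, by push_cast at hpa ⊢; omega⟩
      · obtain ⟨v, hv⟩ := Int.natCast_dvd.2 hpb
        have hpv : ¬ (p : ℤ) ∣ v := by
          rintro ⟨w, rfl⟩
          have := hb p ⟨w, by rw [hv]; ring⟩
          exact not_dvd_neg_one hp (dvd_neg.2 this.dvd)
        have hs := h p hp
        rw [hv, ← isQuadNorm_padic_iff ha (hv ▸ hb0)] at hs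
        exact (exists_dvd_of_jacobiSym hpa).1 (jacobiSym_of_isQuadNorm_padic hpa hpv hs))
    exact ⟨t, Int.natAbs_dvd.1 ht⟩
  obtain ⟨s, ⟨c, hc⟩, hs⟩ := exists_abs_le_dvd_sq_sub hb0 ht
  refine ⟨s, c, hc, ?_⟩
  have h1 : |b| * |c| ≤ |s| ^ 2 + |a| := by
    rw [← abs_mul, ← hc, ← abs_pow]
    exact abs_sub _ _
  have h2 : |s| ^ 2 * 4 ≤ |b| ^ 2 := by nlinarith [abs_nonneg s]
  nlinarith [abs_nonneg c]

lemma isQuadNorm_rat_of_abs_le_one {a b : ℤ} (ha : a ≠ 0) (hb : b ≠ 0) (hab : |a| ≤ |b|)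
    (hb2 : |b| ≤ 1) (h : hilbertSym 2 a b = 1) : IsQuadNorm (a : ℚ) (b : ℚ) := by
  have unit : ∀ x : ℤ, x ≠ 0 → |x| ≤ 1 → x = 1 ∨ x = -1 := by
    intro x hx hx1
    rw [abs_le] at hx1
    omega
  rcases unit b hb hb2 with rfl | rfl
  · simpa using IsQuadNorm.sq (a : ℚ) 1
  · rcases unit a ha (hab.trans hb2) with rfl | rfl
    · simpa using IsQuadNorm.neg_self (1 : ℚ)
    · rw [hilbertSym_two_units (by norm_num) (by norm_num)] at h
      norm_num at h

/-- **Legendre's theorem**: a form `r² - a s² - b z²` that is isotropic at all primes is isotropic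
over `ℚ`. -/
theorem isQuadNorm_rat_of_hilbertSym {a b : ℤ} (ha : a ≠ 0) (hb : b ≠ 0)
    (h : ∀ p : ℕ, p.Prime → hilbertSym p a b = 1) : IsQuadNorm (a : ℚ) (b : ℚ) := by
  induction hN : a.natAbs + b.natAbs using Nat.strong_induction_on generalizing a b with
  | _ N ih =>
  have ha' : (a : ℚ) ≠ 0 := by exact_mod_cast ha
  have hb' : (b : ℚ) ≠ 0 := by exact_mod_cast hb
  wlog hab : |a| ≤ |b| generalizing a b
  · rw [IsQuadNorm.comm ha' hb']
    exact this hb ha (fun p hp => by rw [hilbertSym_comm]; exact h p hp) (by omega) hb' ha'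
      (le_of_not_ge hab)
  by_cases hb2 : |b| ≤ 1
  · exact isQuadNorm_rat_of_abs_le_one ha hb hab hb2 (h 2 Nat.prime_two)
  by_cases hsq : Squarefree b
  · obtain ⟨t, c, hc, hlt⟩ := exists_descent ha hsq hab (by omega) h
    by_cases hc0 : c = 0
    · refine IsQuadNorm.of_isSquare ha' ⟨t, ?_⟩ _
      rw [hc0, mul_zero] at hc
      exact_mod_cast (by linear_combination -hc : a = t * t)
    · have hbc : IsQuadNorm (a : ℚ) ((b * c : ℤ) : ℚ) := ⟨t, 1, by rw [← hc]; push_cast; ring⟩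
      refine IsQuadNorm.of_mul_right (by exact_mod_cast hc0) (ih _ ?_ ha hc0 ?_ rfl)
        (by exact_mod_cast hbc)
      · rw [Int.abs_eq_natAbs, Int.abs_eq_natAbs] at hlt
        omega
      · intro p hp
        have : Fact p.Prime := ⟨hp⟩
        have h1 : hilbertSym p a (b * c) = 1 := by
          rw [← isQuadNorm_padic_iff ha (mul_ne_zero hb hc0)]
          simpa using hbc.map (algebraMap ℚ ℚ_[p])
        rwa [hilbertSym_mul_right hp ha hb hc0, h p hp, one_mul] at h1
  · simp only [Squarefree, not_forall] at hsq
    obtain ⟨x, ⟨c, rfl⟩, hx⟩ := hsq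
    have hx0 : x ≠ 0 := by rintro rfl; simp at hb
    have hc0 : c ≠ 0 := by rintro rfl; simp at hb
    have e : x * x * c = c * x ^ 2 := by ring
    rw [e] at h ⊢
    rw [Int.cast_mul, Int.cast_pow, IsQuadNorm.mul_sq_iff (by exact_mod_cast hx0)]
    refine ih _ ?_ ha hc0 (fun p hp => ?_) rfl
    · have hx1 : x.natAbs ≠ 1 := by rwa [Ne, ← Int.isUnit_iff_natAbs_eq]
      have hx2 : 2 ≤ x.natAbs := by have := Int.natAbs_pos.2 hx0; omega
      have hc1 := Int.natAbs_pos.2 hc0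
      rw [← hN, Int.natAbs_mul, Int.natAbs_mul]
      have h4 : 4 ≤ x.natAbs * x.natAbs := Nat.mul_le_mul hx2 hx2
      nlinarith [Nat.mul_le_mul_right c.natAbs h4]
    · rw [← hilbertSym_mul_sq_right hp ha hc0 hx0]; exact h p hp

end Legendre

section Realization

variable {S : Finset ℕ}

lemma isCoprime_prime_pow {p : ℕ} (hp : p.Prime) {u : ℤ} (hu : ¬ (p : ℤ) ∣ u) (n : ℕ) :
    IsCoprime u ((p : ℤ) ^ n) :=
  (((Nat.prime_iff_prime_int.1 hp).coprime_iff_not_dvd).2 hu).symm.pow_right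

/-- Dirichlet's theorem with prescribed residues at finitely many primes. -/
lemma exists_prime_modEq (hS : ∀ p ∈ S, p.Prime) (r : ℕ → ℤ) (hr : ∀ p ∈ S, ¬ (p : ℤ) ∣ r p) :
    ∃ q : ℕ, q.Prime ∧ q ∉ S ∧ ∀ p ∈ S, (q : ℤ) ≡ r p [ZMOD (p : ℤ) ^ 3] := by
  have hcop : Set.Pairwise (S : Set ℕ) (Function.onFun Nat.Coprime fun p => p ^ 3) :=
    fun p hp q hq hpq => Nat.Coprime.pow _ _ ((Nat.coprime_primes (hS p hp) (hS q hq)).2 hpq)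
  have hne : ∀ p ∈ S, p ^ 3 ≠ 0 := fun p hp => pow_ne_zero _ (hS p hp).ne_zero
  obtain ⟨k, hk⟩ := Nat.chineseRemainderOfFinset (fun p => (r p % (p : ℤ) ^ 3).toNat) (fun p => p ^ 3)
    S hne hcop
  have hk' : ∀ p ∈ S, (k : ℤ) ≡ r p [ZMOD (p : ℤ) ^ 3] := by
    intro p hp
    have h0 : ((p : ℤ) ^ 3) ≠ 0 := by exact_mod_cast hne p hp
    have h := Int.natCast_modEq_iff.2 (hk p hp)
    rw [Int.toNat_of_nonneg (Int.emod_nonneg _ h0)] at h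
    push_cast at h
    exact h.trans (Int.mod_modEq _ _)
  have hkc : IsCoprime (k : ℤ) ((∏ p ∈ S, p ^ 3 : ℕ) : ℤ) := by
    push_cast
    refine IsCoprime.prod_right fun p hp => isCoprime_prime_pow (hS p hp) (fun h => hr p hp ?_) 3
    exact (((hk' p hp).of_dvd (dvd_pow_self _ three_ne_zero)).dvd_iff).1 h
  obtain ⟨q, hqn, hq, hqk⟩ := Nat.forall_exists_prime_gt_and_zmodEq (S.sup id)
    (Finset.prod_ne_zero_iff.2 hne) hkc
  refine ⟨q, hq, fun h => absurd (Finset.le_sup (f := id) h) (not_le.2 hqn), fun p hp => ?_⟩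
  refine (hqk.of_dvd ?_).trans (hk' p hp)
  exact_mod_cast Finset.dvd_prod_of_mem (fun p => p ^ 3) hp

lemma exists_mul_modEq {p : ℕ} (hp : p.Prime) {m u : ℤ} (hm : ¬ (p : ℤ) ∣ m) (hu : ¬ (p : ℤ) ∣ u) :
    ∃ r : ℤ, ¬ (p : ℤ) ∣ r ∧ m * r ≡ u [ZMOD (p : ℤ) ^ 3] := by
  obtain ⟨x, y, hxy⟩ := isCoprime_prime_pow hp hm 3
  have hmod : m * (x * u) ≡ u [ZMOD (p : ℤ) ^ 3] :=
    (Int.modEq_iff_dvd.2 ⟨y * u, by linear_combination -u * hxy⟩)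
  refine ⟨x * u, fun h => hu ?_, hmod⟩
  exact (((hmod.of_dvd (dvd_pow_self _ three_ne_zero)).dvd_iff).1 (h.mul_left m))

lemma exists_prime_mul_hilbertSym_eq (hS : ∀ p ∈ S, p.Prime) (y : ℕ → ℤ) (hy : ∀ p ∈ S, y p ≠ 0)
    {σ : ℤ} (hσ : σ = 1 ∨ σ = -1) :
    ∃ (q : ℕ) (z : ℤ), q.Prime ∧ q ∉ S ∧ z ≠ 0 ∧ (z < 0 ↔ σ < 0) ∧
      (∀ p : ℕ, p.Prime → (p : ℤ) ∣ z → p ∈ insert q S) ∧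
      ∀ p ∈ S, ∀ x : ℤ, x ≠ 0 → hilbertSym p x z = hilbertSym p x (y p) := by
  have hdec : ∀ p : ℕ, ∃ (n : ℕ) (u : ℤ), p ∈ S → (¬ (p : ℤ) ∣ u ∧ y p = (p : ℤ) ^ n * u) := by
    intro p
    by_cases hp : p ∈ S
    · obtain ⟨n, u, h⟩ := exists_eq_pow_mul (hS p hp) (hy p hp)
      exact ⟨n, u, fun _ => h⟩
    · exact ⟨0, 0, fun h => absurd h hp⟩
  choose n u hu using hdec
  set m : ℕ → ℤ := fun p => σ * ∏ l ∈ S.erase p, (l : ℤ) ^ n l with hm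
  have hσp : ∀ p : ℕ, p.Prime → ¬ (p : ℤ) ∣ σ := by
    rintro p hp h
    rcases hσ with rfl | rfl
    · exact not_dvd_neg_one hp (dvd_neg.2 h)
    · exact not_dvd_neg_one hp h
  have hmp : ∀ p ∈ S, ¬ (p : ℤ) ∣ m p := by
    intro p hp
    refine not_dvd_mul (hS p hp) (hσp p (hS p hp)) fun h => ?_
    obtain ⟨l, hl, hd⟩ := (Nat.prime_iff_prime_int.1 (hS p hp)).exists_mem_finset_dvd h
    have := (Nat.prime_iff_prime_int.1 (hS p hp)).dvd_of_dvd_pow hd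
    exact not_dvd_prime (hS p hp) (hS l (Finset.mem_of_mem_erase hl)) (Finset.ne_of_mem_erase hl).symm
      this
  have hr : ∀ p : ℕ, ∃ r : ℤ, p ∈ S → ¬ (p : ℤ) ∣ r ∧ m p * r ≡ u p [ZMOD (p : ℤ) ^ 3] := by
    intro p
    by_cases hp : p ∈ S
    · obtain ⟨r, h⟩ := exists_mul_modEq (hS p hp) (hmp p hp) (hu p hp).1
      exact ⟨r, fun _ => h⟩
    · exact ⟨0, fun h => absurd h hp⟩
  choose r hr using hr
  obtain ⟨q, hq, hqS, hqr⟩ := exists_prime_modEq hS r fun p hp => (hr p hp).1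
  have hpos : 0 < (∏ l ∈ S, (l : ℤ) ^ n l) * q := by
    refine mul_pos (Finset.prod_pos fun l hl => pow_pos ?_ _) ?_
    · exact_mod_cast (hS l hl).pos
    · exact_mod_cast hq.pos
  refine ⟨q, σ * ((∏ l ∈ S, (l : ℤ) ^ n l) * q), hq, hqS, ?_, ?_, ?_, ?_⟩
  · exact mul_ne_zero (by rcases hσ with rfl | rfl <;> norm_num) hpos.ne'
  · rcases hσ with rfl | rfl
    · simp [hpos.le]
    · simp [hpos]
  · intro p hp hd
    have hpi := Nat.prime_iff_prime_int.1 hp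
    rcases hpi.dvd_or_dvd ((hpi.dvd_or_dvd hd).resolve_left (hσp p hp)) with h | h
    · obtain ⟨l, hl, hd⟩ := hpi.exists_mem_finset_dvd h
      by_contra hpS
      refine not_dvd_prime hp (hS l hl) ?_ (hpi.dvd_of_dvd_pow hd)
      rintro rfl
      exact hpS (Finset.mem_insert_of_mem hl)
    · by_contra hpS
      refine not_dvd_prime hp hq ?_ h
      rintro rfl
      exact hpS (Finset.mem_insert_self _ _)
  · intro p hp x hx
    have hqp : ¬ (p : ℤ) ∣ q := not_dvd_prime (hS p hp) hq (by rintro rfl; exact hqS hp)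
    have e : σ * ((∏ l ∈ S, (l : ℤ) ^ n l) * q) = (p : ℤ) ^ n p * (m p * q) := by
      rw [hm, ← Finset.mul_prod_erase S _ hp]
      ring
    rw [e, (hu p hp).2]
    exact hilbertSym_congr (hS p hp) hx (not_dvd_mul (hS p hp) (hmp p hp) hqp) _
      (((hqr p hp).mul_left _).trans (hr p hp).2)

/-- Local symbols prescribed on `S` and trivial elsewhere are realized by a global integer,
provided that they satisfy the product formula. -/
theorem exists_hilbertSym_eq (hS : ∀ p ∈ S, p.Prime) (h2 : 2 ∈ S) (y : ℕ → ℤ)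
    (hy : ∀ p ∈ S, y p ≠ 0) {σ : ℤ} (hσ : σ = 1 ∨ σ = -1) :
    ∃ z : ℤ, z ≠ 0 ∧ ∀ x : ℤ, x ≠ 0 → (∀ p : ℕ, p.Prime → (p : ℤ) ∣ x → p ∈ S) →
      ∏ p ∈ S, hilbertSym p x (y p) = (if x < 0 ∧ σ < 0 then -1 else 1) →
      (∀ p ∈ S, hilbertSym p x z = hilbertSym p x (y p)) ∧
      ∀ p : ℕ, p.Prime → p ∉ S → hilbertSym p x z = 1 := by
  obtain ⟨q, z, hq, hqS, hz, hzσ, hzS, hloc⟩ := exists_prime_mul_hilbertSym_eq hS y hy hσ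
  refine ⟨z, hz, fun x hx hxS hprod => ⟨fun p hp => hloc p hp x hx, fun p hp hpS => ?_⟩⟩
  by_cases hpq : p = q
  · subst hpq
    have h := prod_hilbertSym (S := insert p S)
      (fun l hl => (Finset.mem_insert.1 hl).elim (fun h => h ▸ hq) (hS l))
      (Finset.mem_insert_of_mem h2) hx hz
      (fun l hl hd => Finset.mem_insert_of_mem (hxS l hl hd)) hzS
    rw [Finset.prod_insert hqS, Finset.prod_congr rfl fun l hl => hloc l hl x hx, hprod] at h
    simp only [hzσ] at h
    split_ifs at h <;> omega
  · refine hilbertSym_eq_one_of_not_dvd hp (by rintro rfl; exact hpS h2) (fun h => hpS (hxS p hp h))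
      fun h => ?_
    rcases Finset.mem_insert.1 (hzS p hp h) with h | h
    exacts [hpq h, hpS h]

lemma exists_hilbertSym_eq_neg_one_and {p : ℕ} (hp : p.Prime) {a b z w : ℤ} (ha : a ≠ 0) (hb : b ≠ 0)
    (hz : z ≠ 0) (hw : w ≠ 0) (haz : hilbertSym p a z = -1) (hbw : hilbertSym p b w = -1) :
    ∃ y : ℤ, y ≠ 0 ∧ hilbertSym p a y = -1 ∧ hilbertSym p b y = -1 := by
  rcases hilbertSym_eq_one_or hp hb hz with h | h
  · rcases hilbertSym_eq_one_or hp ha hw with h' | h'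
    · refine ⟨z * w, mul_ne_zero hz hw, ?_, ?_⟩
      · rw [hilbertSym_mul_right hp ha hz hw, haz, h', mul_one]
      · rw [hilbertSym_mul_right hp hb hz hw, hbw, h, one_mul]
    · exact ⟨w, hw, h', hbw⟩
  · exact ⟨z, hz, haz, h⟩

/-- An auxiliary negative integer, a square at the primes of `S` outside `P` and a nonsquare at
those in `P`. -/
lemma exists_neg_hilbertSym (hS : ∀ p ∈ S, p.Prime) (P : ℕ → Prop) :
    ∃ c : ℤ, c < 0 ∧ (∀ p ∈ S, P p → ∃ z : ℤ, z ≠ 0 ∧ hilbertSym p c z = -1) ∧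
      ∀ p ∈ S, ¬ P p → ∀ z : ℤ, z ≠ 0 → hilbertSym p c z = 1 := by
  have hr : ∀ p : ℕ, ∃ r : ℤ, p ∈ S → ¬ (p : ℤ) ∣ r ∧
      (P p → hilbertSym p p r = -1) ∧ (¬ P p → r = 1) := by
    intro p
    by_cases hp : p ∈ S
    · have hpp := hS p hp
      by_cases hP : P p
      · by_cases h2 : p = 2
        · subst h2
          refine ⟨5, fun _ => ⟨by norm_num, fun _ => ?_, fun h => absurd hP h⟩⟩
          rw [hilbertSym_comm, Nat.cast_ofNat, hilbertSym_two_right (by norm_num),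
            ZMod.χ₈_int_eq_if_mod_eight]
          norm_num
        · obtain ⟨w, hw, hj⟩ := exists_jacobiSym_eq_neg_one hpp h2
          refine ⟨w, fun _ => ⟨hw, fun _ => ?_, fun h => absurd hP h⟩⟩
          rw [hilbertSym_comm, hilbertSym_prime_right hpp h2 hw, hj]
      · exact ⟨1, fun _ => ⟨not_dvd_neg_one hpp ∘ dvd_neg.2, fun h => absurd h hP, fun _ => rfl⟩⟩
    · exact ⟨0, fun h => absurd h hp⟩
  choose r hr using hr
  obtain ⟨q, hq, hqS, hqr⟩ := exists_prime_modEq hS (fun p => -r p) fun p hp => by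
    rw [dvd_neg]; exact (hr p hp).1
  have key : ∀ p ∈ S, ∀ z : ℤ, z ≠ 0 → hilbertSym p (-q : ℤ) z = hilbertSym p z (r p) := by
    intro p hp z hz
    have hqp : ¬ (p : ℤ) ∣ -q := by
      rw [dvd_neg]; exact not_dvd_prime (hS p hp) hq (by rintro rfl; exact hqS hp)
    have := hilbertSym_congr (hS p hp) hz hqp 0 (by simpa using (hqr p hp).neg)
    simpa [hilbertSym_comm] using this
  refine ⟨-q, by simpa using hq.pos, fun p hp hP => ?_, fun p hp hP z hz => ?_⟩
  · have hp0 : (p : ℤ) ≠ 0 := by exact_mod_cast (hS p hp).ne_zero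
    exact ⟨p, hp0, by rw [key p hp p hp0, (hr p hp).2.1 hP]⟩
  · rw [key p hp z hz, (hr p hp).2.2 hP, hilbertSym_one_right (hS p hp) hz]

/-- The split and nonsplit parts of the ramification of `(A, B)` separately satisfy a product
formula up to a common sign, hence can be carried by a single integer `y`. -/
theorem exists_common_slot (P : ℕ → Prop) {A B c D : ℤ} (hA : 0 < A) (hB : B ≠ 0) (hc : c < 0)
    (hD : D < 0)
    (hcP : ∀ p : ℕ, p.Prime → hilbertSym p A B = -1 → P p → ∃ z : ℤ, z ≠ 0 ∧ hilbertSym p c z = -1)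
    (hcP' : ∀ p : ℕ, p.Prime → hilbertSym p A B = -1 → ¬ P p →
      ∀ z : ℤ, z ≠ 0 → hilbertSym p c z = 1)
    (hDP : ∀ p : ℕ, p.Prime → ¬ P p → ∃ z : ℤ, z ≠ 0 ∧ hilbertSym p D z = -1)
    (hDP' : ∀ p : ℕ, p.Prime → P p → ∀ z : ℤ, z ≠ 0 → hilbertSym p D z = 1) :
    ∃ y : ℤ, y ≠ 0 ∧ ∀ p : ℕ, p.Prime → hilbertSym p A y = hilbertSym p A B ∧
      hilbertSym p c y = (if P p then hilbertSym p A B else 1) ∧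
      hilbertSym p D y = (if P p then 1 else hilbertSym p A B) := by
  have hA0 := hA.ne'
  have hc0 := hc.ne
  have hD0 := hD.ne
  set S : Finset ℕ := (2 * A * B * c * D).natAbs.primeFactors with hSdef
  have hS : ∀ p ∈ S, p.Prime := fun p hp => Nat.prime_of_mem_primeFactors hp
  have hN0 : 2 * A * B * c * D ≠ 0 := by positivity
  have hmem : ∀ {x : ℤ}, x ∣ 2 * A * B * c * D → ∀ p : ℕ, p.Prime → (p : ℤ) ∣ x → p ∈ S := by
    intro x hx p hp hpx
    rw [hSdef, Nat.mem_primeFactors]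
    exact ⟨hp, Int.natCast_dvd.1 (hpx.trans hx), by simpa using hN0⟩
  have h2S : 2 ∈ S := hmem ⟨A * B * c * D, by ring⟩ 2 Nat.prime_two (dvd_refl 2)
  have hAS := hmem (x := A) ⟨2 * B * c * D, by ring⟩
  have hBS := hmem (x := B) ⟨2 * A * c * D, by ring⟩
  have hcS := hmem (x := c) ⟨2 * A * B * D, by ring⟩
  have hDS := hmem (x := D) ⟨2 * A * B * c, by ring⟩
  have hloc : ∀ p : ℕ, ∃ y : ℤ, p.Prime → y ≠ 0 ∧ hilbertSym p A y = hilbertSym p A B ∧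
      hilbertSym p c y = (if P p then hilbertSym p A B else 1) ∧
      hilbertSym p D y = (if P p then 1 else hilbertSym p A B) := by
    intro p
    by_cases hp : p.Prime
    swap
    · exact ⟨0, fun h => absurd h hp⟩
    rcases hilbertSym_eq_one_or hp hA0 hB with h | h
    · exact ⟨1, fun _ => by simp [h, hilbertSym_one_right hp, hA0, hc0, hD0]⟩
    · by_cases hP : P p
      · obtain ⟨z, hz, hcz⟩ := hcP p hp h hP
        obtain ⟨y, hy, h1, h3⟩ := exists_hilbertSym_eq_neg_one_and hp hA0 hc0 hB hz h hcz
        exact ⟨y, fun _ => ⟨hy, by rw [h1, h], by rw [if_pos hP, h3, h],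
          by rw [if_pos hP, hDP' p hp hP y hy]⟩⟩
      · obtain ⟨z, hz, hDz⟩ := hDP p hp hP
        obtain ⟨y, hy, h1, h3⟩ := exists_hilbertSym_eq_neg_one_and hp hA0 hD0 hB hz h hDz
        exact ⟨y, fun _ => ⟨hy, by rw [h1, h], by rw [if_neg hP, hcP' p hp h hP y hy],
          by rw [if_neg hP, h3, h]⟩⟩
  choose y hy using hloc
  set σ : ℤ := ∏ p ∈ S, (if P p then hilbertSym p A B else 1) with hσdef
  have hσ : σ = 1 ∨ σ = -1 := by
    refine Finset.prod_induction _ (fun t : ℤ => t = 1 ∨ t = -1) ?_ (Or.inl rfl) ?_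
    · rintro a b (rfl | rfl) (rfl | rfl) <;> simp
    · intro p hp
      split_ifs
      exacts [hilbertSym_eq_one_or (hS p hp) hA0 hB, Or.inl rfl]
  have hprod := prod_hilbertSym hS h2S hA0 hB hAS hBS
  rw [if_neg (fun h => absurd h.1 hA.le.not_gt)] at hprod
  have hσ' : ∏ p ∈ S, (if P p then 1 else hilbertSym p A B) = σ := by
    have : (∏ p ∈ S, (if P p then 1 else hilbertSym p A B)) * σ = 1 := by
      rw [hσdef, ← Finset.prod_mul_distrib]
      refine (Finset.prod_congr rfl fun p _ => ?_).trans hprod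
      split_ifs <;> simp
    rcases hσ with h | h <;> rw [h] at this ⊢ <;> omega
  obtain ⟨z, hz, hzx⟩ := exists_hilbertSym_eq hS h2S y (fun p hp => (hy p (hS p hp)).1) hσ
  have hσif : σ = if σ < 0 then -1 else 1 := by rcases hσ with h | h <;> rw [h] <;> norm_num
  have hzA := hzx A hA0 hAS (by
    rw [if_neg (fun h => absurd h.1 hA.le.not_gt), ← hprod]
    exact Finset.prod_congr rfl fun p hp => (hy p (hS p hp)).2.1)
  have hzc := hzx c hc0 hcS (by
    simp only [hc, true_and]
    rw [← hσif]
    exact Finset.prod_congr rfl fun p hp => (hy p (hS p hp)).2.2.1)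
  have hzD := hzx D hD0 hDS (by
    simp only [hD, true_and]
    rw [← hσif, ← hσ']
    exact Finset.prod_congr rfl fun p hp => (hy p (hS p hp)).2.2.2)
  refine ⟨z, hz, fun p hp => ?_⟩
  by_cases hpS : p ∈ S
  · rw [hzA.1 p hpS, hzc.1 p hpS, hzD.1 p hpS]
    exact (hy p hp).2
  · have h1 : hilbertSym p A B = 1 := hilbertSym_eq_one_of_not_dvd hp
      (by rintro rfl; exact hpS h2S) (fun h => hpS (hAS p hp h)) (fun h => hpS (hBS p hp h))
    rw [hzA.2 p hp hpS, hzc.2 p hp hpS, hzD.2 p hp hpS, h1]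
    simp

end Realization

section QuaternionRep

/-- The algebra `M` contains two anticommuting elements with squares `α` and `β`. -/
def QuatRep {K : Type*} [CommRing K] (M : Type*) [Ring M] [Algebra K M] (α β : K) : Prop :=
  ∃ i j : M, i * i = algebraMap K M α ∧ j * j = algebraMap K M β ∧ i * j = -(j * i)

namespace QuatRep

variable {K M : Type*} [Field K] [Ring M] [Algebra K M] {α β γ : K}

lemma symm (h : QuatRep M α β) : QuatRep M β α := by
  obtain ⟨i, j, hi, hj, hij⟩ := h
  exact ⟨j, i, hj, hi, by rw [hij, neg_neg]⟩

lemma mul_sq_left (h : QuatRep M α β) (t : K) : QuatRep M (α * t ^ 2) β := by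
  obtain ⟨i, j, hi, hj, hij⟩ := h
  refine ⟨t • i, j, ?_, hj, ?_⟩
  · rw [smul_mul_smul_comm, hi, ← pow_two, Algebra.smul_def, ← map_mul, mul_comm]
  · rw [smul_mul_assoc, hij, smul_neg, mul_smul_comm]

lemma mul_left_of_central (h : QuatRep M α β) {D : K} {δ : M} (hδ : ∀ x, δ * x = x * δ)
    (hD : δ * δ = algebraMap K M D) : QuatRep M (D * α) β := by
  obtain ⟨i, j, hi, hj, hij⟩ := h
  refine ⟨δ * i, j, ?_, hj, ?_⟩
  · rw [mul_assoc, ← mul_assoc i, ← hδ, mul_assoc, ← mul_assoc δ, hi, hD, map_mul]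
  · rw [mul_assoc, hij, mul_neg, ← mul_assoc, hδ, mul_assoc]

lemma of_isQuadNorm (h : QuatRep M α β) (hβ : β ≠ 0) (hn : IsQuadNorm α (β * γ)) :
    QuatRep M α γ := by
  obtain ⟨i, j, hi, hj, hij⟩ := h
  obtain ⟨r, s, hrs⟩ := hn
  have hr : ∀ x : M, algebraMap K M r * x = x * algebraMap K M r := Algebra.commutes r
  have hs : ∀ x : M, algebraMap K M s * x = x * algebraMap K M s := Algebra.commutes s
  set ρ := algebraMap K M r
  set τ := algebraMap K M s
  have hsq : ((ρ + τ * i) * j) * ((ρ + τ * i) * j) = algebraMap K M (β ^ 2 * γ) := by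
    have e1 : j * (ρ + τ * i) = (ρ - τ * i) * j := by
      rw [mul_add, sub_mul, ← hr, ← mul_assoc, ← hs, mul_assoc τ j, mul_assoc τ i, hij]
      noncomm_ring
    have e2 : (ρ + τ * i) * (ρ - τ * i) = algebraMap K M (β * γ) := by
      rw [hrs, mul_comm α, map_sub, map_mul, map_pow, map_pow, ← hi]
      have e3 : τ * i * (τ * i) = τ ^ 2 * (i * i) := by
        rw [mul_assoc, ← mul_assoc i, ← hs i, mul_assoc τ i, ← mul_assoc τ τ, ← sq]
      rw [mul_sub, add_mul, add_mul, e3, mul_assoc τ, ← hr i, ← mul_assoc τ, hs ρ, mul_assoc ρ]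
      noncomm_ring
    rw [mul_assoc, ← mul_assoc j, e1, mul_assoc, ← mul_assoc, e2, hj, ← map_mul]
    congr 1
    ring
  refine ⟨i, β⁻¹ • ((ρ + τ * i) * j), hi, ?_, ?_⟩
  · rw [smul_mul_smul_comm, hsq, Algebra.smul_def, ← map_mul]
    congr 1
    field_simp
  · rw [mul_smul_comm, smul_mul_assoc, ← smul_neg]
    congr 1
    have hc : i * (ρ + τ * i) = (ρ + τ * i) * i := by
      rw [mul_add, add_mul, hr, ← mul_assoc, ← hs, mul_assoc]
    rw [← mul_assoc, hc, mul_assoc, hij, mul_neg, mul_assoc]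

lemma nonempty_algHom_iff : Nonempty (ℍ[K, α, β] →ₐ[K] M) ↔ QuatRep M α β := by
  constructor
  · rintro ⟨φ⟩
    let q := QuaternionAlgebra.lift.symm φ
    refine ⟨q.i, q.j, ?_, ?_, ?_⟩
    · rw [q.i_mul_i, zero_smul, add_zero, Algebra.algebraMap_eq_smul_one]
    · rw [q.j_mul_j, Algebra.algebraMap_eq_smul_one]
    · rw [q.i_mul_j, q.j_mul_i, zero_smul, zero_sub, neg_neg]
  · rintro ⟨i, j, hi, hj, hij⟩
    exact ⟨QuaternionAlgebra.lift
      { i := i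
        j := j
        k := i * j
        i_mul_i := by rw [hi, zero_smul, add_zero, Algebra.algebraMap_eq_smul_one]
        j_mul_j := by rw [hj, Algebra.algebraMap_eq_smul_one]
        i_mul_j := rfl
        j_mul_i := by rw [zero_smul, zero_sub, hij, neg_neg] }⟩

end QuatRep

variable {K : Type*} [Field K] {a b a' b' : K}

lemma QuaternionAlgebra.star_mul_self_eq (u : ℍ[K, a, b]) : star u * u =
    algebraMap K _ (u.re ^ 2 - a * u.imI ^ 2 - b * (u.imJ ^ 2 - a * u.imK ^ 2)) := by
  ext <;> simp [sq] <;> ring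

lemma isSquare_of_sq_sub_eq_zero {x y : K} (h : x ^ 2 - a * y ^ 2 = 0) (hxy : x ≠ 0 ∨ y ≠ 0) :
    IsSquare a := by
  have hy : y ≠ 0 := by
    rintro rfl
    simp_all
  refine ⟨x / y, ?_⟩
  field_simp
  linear_combination -h

variable [NeZero (2 : K)]

/-- A quaternion algebra is a division algebra iff its Hilbert equation is not solvable. -/
lemma QuaternionAlgebra.noZeroDivisors_iff (ha : a ≠ 0) :
    NoZeroDivisors ℍ[K, a, b] ↔ ¬ IsQuadNorm a b := by
  constructor
  · rintro h ⟨r, s, hrs⟩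
    have hu := QuaternionAlgebra.star_mul_self_eq (⟨r, s, 1, 0⟩ : ℍ[K, a, b])
    rw [show r ^ 2 - a * s ^ 2 - b * ((1 : K) ^ 2 - a * 0 ^ 2) = 0 by rw [hrs]; ring, map_zero] at hu
    rcases mul_eq_zero.1 hu with h | h
    · simpa using congrArg QuaternionAlgebra.imJ h
    · simpa using congrArg QuaternionAlgebra.imJ h
  · intro h
    have hsq : ∀ {x y : K}, x ^ 2 - a * y ^ 2 = 0 → x = 0 ∧ y = 0 := by
      intro x y hxy
      by_contra hne
      exact h (IsQuadNorm.of_isSquare ha (isSquare_of_sq_sub_eq_zero hxy (by tauto)) b)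
    refine ⟨fun {u v} huv => or_iff_not_imp_left.2 fun hu => ?_⟩
    have h1 : star u * (u * v) = 0 := by rw [huv, mul_zero]
    rw [← mul_assoc, QuaternionAlgebra.star_mul_self_eq, ← Algebra.smul_def, smul_eq_zero] at h1
    refine h1.resolve_left fun h0 => hu ?_
    by_cases hJK : u.imJ ^ 2 - a * u.imK ^ 2 = 0
    · rw [hJK, mul_zero, sub_zero] at h0
      exact QuaternionAlgebra.ext (hsq h0).1 (hsq h0).2 (hsq hJK).1 (hsq hJK).2
    · exact absurd (IsQuadNorm.of_mul_right hJK ⟨_, _, rfl⟩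
        ⟨u.re, u.imI, by linear_combination -h0⟩) h

lemma QuaternionAlgebra.injective_of_algHom {M : Type*} [Ring M] [Nontrivial M] [Algebra K M]
    (ha : a ≠ 0) (hb : b ≠ 0) (φ : ℍ[K, a, b] →ₐ[K] M) : Function.Injective φ := by
  have hre : ∀ q : ℍ[K, a, b], φ q = 0 → q.re = 0 := by
    intro q hq
    have e : q + a⁻¹ • (⟨0, 1, 0, 0⟩ * q * ⟨0, 1, 0, 0⟩) + b⁻¹ • (⟨0, 0, 1, 0⟩ * q * ⟨0, 0, 1, 0⟩) -
        (a * b)⁻¹ • (⟨0, 0, 0, 1⟩ * q * ⟨0, 0, 0, 1⟩) = algebraMap K ℍ[K, a, b] (2 * 2 * q.re) := by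
      ext <;> simp <;> field_simp <;> ring
    have h := congrArg φ e
    simp only [map_add, map_sub, map_smul, map_mul φ, hq, mul_zero, zero_mul, smul_zero, add_zero,
      sub_zero, AlgHom.commutes] at h
    have h4 := (algebraMap K M).injective (h.symm.trans (map_zero _).symm)
    exact (mul_eq_zero.1 h4).resolve_left (mul_ne_zero two_ne_zero two_ne_zero)
  refine (injective_iff_map_eq_zero φ).2 fun q hq => ?_
  have hmul : ∀ x : ℍ[K, a, b], (q * x).re = 0 := fun x => hre _ (by rw [map_mul, hq, zero_mul])
  have hI := hmul ⟨0, 1, 0, 0⟩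
  have hJ := hmul ⟨0, 0, 1, 0⟩
  have hK := hmul ⟨0, 0, 0, 1⟩
  simp [ha, hb] at hI hJ hK
  exact QuaternionAlgebra.ext (hre q hq) hI hJ hK

/-- A quaternion algebra containing another one is isomorphic to it; in particular they split
simultaneously. -/
lemma QuatRep.isQuadNorm_iff (ha : a ≠ 0) (ha' : a' ≠ 0) (hb' : b' ≠ 0)
    (h : QuatRep ℍ[K, a, b] a' b') : IsQuadNorm a b ↔ IsQuadNorm a' b' := by
  obtain ⟨φ⟩ := QuatRep.nonempty_algHom_iff.2 h
  have hinj := QuaternionAlgebra.injective_of_algHom ha' hb' φ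
  have hsurj : Function.Surjective φ :=
    (LinearMap.injective_iff_surjective_of_finrank_eq_finrank (f := φ.toLinearMap)
      (by rw [QuaternionAlgebra.finrank_eq_four, QuaternionAlgebra.finrank_eq_four])).1 hinj
  let e := AlgEquiv.ofBijective φ ⟨hinj, hsurj⟩
  rw [← not_iff_not, ← QuaternionAlgebra.noZeroDivisors_iff ha,
    ← QuaternionAlgebra.noZeroDivisors_iff ha']
  exact ⟨fun _ => e.injective.noZeroDivisors e (map_zero e) (map_mul e),
    fun _ => e.symm.injective.noZeroDivisors e.symm (map_zero e.symm) (map_mul e.symm)⟩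

end QuaternionRep

section Embedding

/-- The arithmetic input for the transfer of quaternion algebras over `ℚ(√D)`. -/
theorem exists_isQuadNorm_chain {A B A' B' D : ℤ} (hA : 0 < A) (hB : B ≠ 0) (hA' : 0 < A')
    (hB' : B' ≠ 0) (hD : D < 0) (P : ℕ → Prop)
    (hDP : ∀ p : ℕ, p.Prime → ¬ P p → ∃ z : ℤ, z ≠ 0 ∧ hilbertSym p D z = -1)
    (hDP' : ∀ p : ℕ, p.Prime → P p → ∀ z : ℤ, z ≠ 0 → hilbertSym p D z = 1)
    (h : ∀ p : ℕ, p.Prime → P p → hilbertSym p A B = hilbertSym p A' B') :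
    ∃ c y y' : ℤ, c ≠ 0 ∧ y ≠ 0 ∧ y' ≠ 0 ∧ IsQuadNorm (A : ℚ) ((B * y : ℤ) : ℚ) ∧
      IsQuadNorm (y : ℚ) ((A * (D * c) : ℤ) : ℚ) ∧ IsQuadNorm (c : ℚ) ((y * y' : ℤ) : ℚ) ∧
      IsQuadNorm (A' : ℚ) ((B' * y' : ℤ) : ℚ) ∧
      IsQuadNorm (y' : ℚ) ((A' * (D * c) : ℤ) : ℚ) := by
  set S : Finset ℕ := (2 * A * B * A' * B').natAbs.primeFactors with hSdef
  have hS : ∀ p ∈ S, p.Prime := fun p hp => Nat.prime_of_mem_primeFactors hp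
  have hN0 : 2 * A * B * A' * B' ≠ 0 := by positivity
  have hmem : ∀ {a b : ℤ} (p : ℕ), p.Prime → 2 * (a * b) ∣ 2 * A * B * A' * B' →
      hilbertSym p a b = -1 → p ∈ S := by
    intro a b p hp hd hab
    rw [hSdef, Nat.mem_primeFactors]
    refine ⟨hp, ?_, by simpa using hN0⟩
    rw [← Int.natCast_dvd]
    refine dvd_trans ?_ hd
    by_contra hnd
    rw [hilbertSym_eq_one_of_not_dvd hp] at hab
    · norm_num at hab
    · rintro rfl
      exact hnd (dvd_mul_right _ _)
    · exact fun h => hnd ((h.mul_right b).mul_left 2)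
    · exact fun h => hnd ((h.mul_left a).mul_left 2)
  have hmemF : ∀ p : ℕ, p.Prime → hilbertSym p A B = -1 → p ∈ S := fun p hp =>
    hmem p hp ⟨A' * B', by ring⟩
  have hmemE : ∀ p : ℕ, p.Prime → hilbertSym p A' B' = -1 → p ∈ S := fun p hp =>
    hmem p hp ⟨A * B, by ring⟩
  obtain ⟨c, hc, hcP, hcP'⟩ := exists_neg_hilbertSym hS P
  obtain ⟨y, hy, hys⟩ := exists_common_slot P hA hB hc hD (fun p hp h => hcP p (hmemF p hp h))
    (fun p hp h => hcP' p (hmemF p hp h)) hDP hDP'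
  obtain ⟨y', hy', hys'⟩ := exists_common_slot P hA' hB' hc hD (fun p hp h => hcP p (hmemE p hp h))
    (fun p hp h => hcP' p (hmemE p hp h)) hDP hDP'
  have hc0 := hc.ne
  have hD0 := hD.ne
  have side : ∀ {A B y : ℤ}, A ≠ 0 → B ≠ 0 → y ≠ 0 →
      (∀ p : ℕ, p.Prime → hilbertSym p A y = hilbertSym p A B ∧
        hilbertSym p c y = (if P p then hilbertSym p A B else 1) ∧
        hilbertSym p D y = (if P p then 1 else hilbertSym p A B)) →
      IsQuadNorm (A : ℚ) ((B * y : ℤ) : ℚ) ∧ IsQuadNorm (y : ℚ) ((A * (D * c) : ℤ) : ℚ) := by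
    intro A B y hA hB hy hys
    refine ⟨isQuadNorm_rat_of_hilbertSym hA (mul_ne_zero hB hy) fun p hp => ?_,
      isQuadNorm_rat_of_hilbertSym hy (mul_ne_zero hA (mul_ne_zero hD0 hc0)) fun p hp => ?_⟩
    · rw [hilbertSym_mul_right hp hA hB hy, (hys p hp).1, hilbertSym_mul_self hp hA hB]
    · obtain ⟨h1, h2, h3⟩ := hys p hp
      rw [hilbertSym_mul_right hp hy hA (mul_ne_zero hD0 hc0), hilbertSym_mul_right hp hy hD0 hc0,
        hilbertSym_comm y A, hilbertSym_comm y D, hilbertSym_comm y c, h1, h2, h3]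
      split_ifs <;> simp [hilbertSym_mul_self hp hA hB]
  refine ⟨c, y, y', hc0, hy, hy', (side hA.ne' hB hy hys).1, (side hA.ne' hB hy hys).2, ?_,
    (side hA'.ne' hB' hy' hys').1, (side hA'.ne' hB' hy' hys').2⟩
  refine isQuadNorm_rat_of_hilbertSym hc0 (mul_ne_zero hy hy') fun p hp => ?_
  rw [hilbertSym_mul_right hp hc0 hy hy', (hys p hp).2.1, (hys' p hp).2.1]
  split_ifs with hP
  · rw [h p hp hP, hilbertSym_mul_self hp hA'.ne' hB']
  · rfl

lemma QuatRep.transfer {M : Type*} [Ring M] [Algebra ℚ M] {δ : M} (hδ : ∀ x, δ * x = x * δ)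
    {A B A' B' D : ℤ} (hδD : δ * δ = algebraMap ℚ M D) (hA : 0 < A) (hB : B ≠ 0) (hA' : 0 < A')
    (hB' : B' ≠ 0) (hD : D < 0) (P : ℕ → Prop)
    (hDP : ∀ p : ℕ, p.Prime → ¬ P p → ∃ z : ℤ, z ≠ 0 ∧ hilbertSym p D z = -1)
    (hDP' : ∀ p : ℕ, p.Prime → P p → ∀ z : ℤ, z ≠ 0 → hilbertSym p D z = 1)
    (h : ∀ p : ℕ, p.Prime → P p → hilbertSym p A B = hilbertSym p A' B')
    (hM : QuatRep M (A : ℚ) (B : ℚ)) : QuatRep M (A' : ℚ) (B' : ℚ) := by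
  obtain ⟨c, y, y', hc, hy, hy', h1, h2, h3, h4, h5⟩ :=
    exists_isQuadNorm_chain hA hB hA' hB' hD P hDP hDP' h
  have hne : ∀ {x : ℤ}, x ≠ 0 → (x : ℚ) ≠ 0 := fun hx => Int.cast_ne_zero.2 hx
  have hDc : ((D : ℚ) * c) ≠ 0 := mul_ne_zero (hne hD.ne) (hne hc)
  push_cast at h1 h2 h3 h4 h5
  have r1 : QuatRep M (D * c : ℚ) (y : ℚ) :=
    ((hM.of_isQuadNorm (hne hB) h1).symm.of_isQuadNorm (hne hA.ne') h2).symm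
  have r2 : QuatRep M (c : ℚ) (y : ℚ) := by
    have := (r1.mul_left_of_central hδ hδD).mul_sq_left (D : ℚ)⁻¹
    have hD0 := hne hD.ne
    rwa [show (D : ℚ) * (D * c) * (D : ℚ)⁻¹ ^ 2 = c by field_simp] at this
  have r3 : QuatRep M (y' : ℚ) (D * c : ℚ) :=
    ((r2.of_isQuadNorm (hne hy) h3).mul_left_of_central hδ hδD).symm
  rw [mul_comm] at h4
  have r4 : QuatRep M (A' : ℚ) (y' : ℚ) := by
    refine (r3.of_isQuadNorm hDc ?_).symm
    rwa [mul_comm] at h5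
  exact r4.of_isQuadNorm (hne hy') h4

/-- Over a field containing `√D`, `D < 0`, every rational quaternion algebra has integral
parameters the first of which is positive. -/
lemma exists_pos_int_eq_mul_sq {D : ℤ} (hD : D < 0) {a : ℚ} (ha : a ≠ 0) :
    ∃ (A : ℤ) (t : ℚ), 0 < A ∧ t ≠ 0 ∧ ((A : ℚ) = a * t ^ 2 ∨ (A : ℚ) = D * a * t ^ 2) := by
  have hden : (a.den : ℚ) ≠ 0 := by exact_mod_cast a.den_ne_zero
  have hnum : (a.num * a.den : ℚ) = a * a.den ^ 2 := by
    rw [sq, ← mul_assoc, Rat.mul_den_eq_num]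
  have hpos : (0 : ℤ) < a.den := by exact_mod_cast a.den_pos
  rcases lt_or_gt_of_ne ha with h | h
  · refine ⟨D * (a.num * a.den), a.den, ?_, hden, Or.inr ?_⟩
    · exact mul_pos_of_neg_of_neg hD (mul_neg_of_neg_of_pos (Rat.num_neg.2 h) hpos)
    · push_cast
      rw [hnum, mul_assoc]
  · exact ⟨a.num * a.den, a.den, mul_pos (Rat.num_pos.2 h) hpos, hden, Or.inl (by exact_mod_cast hnum)⟩

lemma exists_int_eq_mul_sq {b : ℚ} (hb : b ≠ 0) :
    ∃ (B : ℤ) (t : ℚ), B ≠ 0 ∧ t ≠ 0 ∧ (B : ℚ) = b * t ^ 2 := by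
  refine ⟨b.num * b.den, b.den, mul_ne_zero (Rat.num_ne_zero.2 hb) (by exact_mod_cast b.den_ne_zero),
    by exact_mod_cast b.den_ne_zero, ?_⟩
  push_cast
  rw [sq, ← mul_assoc, Rat.mul_den_eq_num]

lemma QuatRep.mul_sq_left_iff {K M : Type*} [Field K] [Ring M] [Algebra K M] {α β t : K}
    (ht : t ≠ 0) : QuatRep M (α * t ^ 2) β ↔ QuatRep M α β := by
  refine ⟨fun h => ?_, fun h => h.mul_sq_left t⟩
  have := h.mul_sq_left t⁻¹
  rwa [show α * t ^ 2 * t⁻¹ ^ 2 = α by field_simp] at this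

lemma QuatRep.central_mul_left_iff {K M : Type*} [Field K] [Ring M] [Algebra K M] {α β D : K}
    {δ : M} (hδ : ∀ x, δ * x = x * δ) (hδD : δ * δ = algebraMap K M D) (hD : D ≠ 0) :
    QuatRep M (D * α) β ↔ QuatRep M α β := by
  refine ⟨fun h => ?_, fun h => h.mul_left_of_central hδ hδD⟩
  have := h.mul_left_of_central hδ hδD
  rwa [← mul_assoc, mul_comm, ← sq, QuatRep.mul_sq_left_iff hD] at this

/-- Integral parameters for a quaternion algebra, with positive first parameter, which are
equivalent to the given ones over every algebra containing a central `√D`. -/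
lemma exists_int_params {D : ℤ} (hD : D < 0) {a b : ℚ} (ha : a ≠ 0) (hb : b ≠ 0) :
    ∃ A B : ℤ, 0 < A ∧ B ≠ 0 ∧
      (∀ (M : Type) [Ring M] [Algebra ℚ M] (δ : M), (∀ x, δ * x = x * δ) →
        δ * δ = algebraMap ℚ M D → (QuatRep M (A : ℚ) (B : ℚ) ↔ QuatRep M a b)) ∧
      ∀ (K : Type) [Field K] [CharZero K], IsSquare (D : K) →
        (IsQuadNorm (A : K) (B : K) ↔ IsQuadNorm (a : K) (b : K)) := by
  obtain ⟨A, t, hA, ht, hAt⟩ := exists_pos_int_eq_mul_sq hD ha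
  obtain ⟨B, s, hB, hs, hBs⟩ := exists_int_eq_mul_sq hb
  refine ⟨A, B, hA, hB, fun M _ _ δ hδ hδD => ?_, fun K _ _ hDK => ?_⟩
  · have e : QuatRep M (A : ℚ) (B : ℚ) ↔ QuatRep M a (B : ℚ) := by
      rcases hAt with h | h <;> rw [h, QuatRep.mul_sq_left_iff ht]
      exact QuatRep.central_mul_left_iff hδ hδD (Int.cast_ne_zero.2 hD.ne)
    rw [e]
    have comm : ∀ x y : ℚ, QuatRep M x y ↔ QuatRep M y x := fun _ _ => ⟨QuatRep.symm, QuatRep.symm⟩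
    rw [comm, hBs, QuatRep.mul_sq_left_iff hs, comm]
  · have hsK : (s : K) ≠ 0 := Rat.cast_ne_zero.2 hs
    have htK : (t : K) ≠ 0 := Rat.cast_ne_zero.2 ht
    have eB : (B : K) = b * s ^ 2 := by exact_mod_cast congrArg (Rat.cast : ℚ → K) hBs
    rw [eB, IsQuadNorm.mul_sq_iff hsK]
    rcases hAt with h | h
    · have eA : (A : K) = a * t ^ 2 := by exact_mod_cast congrArg (Rat.cast : ℚ → K) h
      rw [eA, IsQuadNorm.mul_sq_left_iff htK]
    · obtain ⟨x, hx⟩ := hDK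
      have hx0 : x ≠ 0 := by
        rintro rfl
        rw [mul_zero] at hx
        exact hD.ne (by exact_mod_cast hx)
      have eA : (A : K) = D * a * t ^ 2 := by exact_mod_cast congrArg (Rat.cast : ℚ → K) h
      rw [eA, IsQuadNorm.mul_sq_left_iff htK, hx, show x * x * (a : K) = a * x ^ 2 by ring,
        IsQuadNorm.mul_sq_left_iff hx0]

lemma hilbertOne_iff_isQuadNorm {K : Type*} [Field K] [CharZero K] [Algebra ℚ K] {a b : ℚ}
    (ha : a ≠ 0) (hb : b ≠ 0) : HilbertOne K a b ↔ IsQuadNorm (a : K) (b : K) := by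
  rw [IsQuadNorm.iff_exists_eq_one (Rat.cast_ne_zero.2 ha) (Rat.cast_ne_zero.2 hb), HilbertOne]
  simp only [eq_ratCast]

variable {d : ℕ}

lemma splitsInK_iff_isSquare {p : ℕ} [hp : Fact p.Prime] :
    SplitsInK d p hp.out ↔ IsSquare (((-d : ℤ) : ℤ) : ℚ_[p]) := by
  simp only [SplitsInK, isSquare_iff_exists_sq, eq_comm]
  push_cast
  rfl

lemma qkRoot_mul_self : QkRoot d * QkRoot d = algebraMap ℚ (Qk d) (-d : ℚ) := by
  have h := AdjoinRoot.eval₂_root ((Polynomial.X : ℚ[X]) ^ 2 + Polynomial.C (d : ℚ))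
  simp only [Polynomial.eval₂_add, Polynomial.eval₂_pow, Polynomial.eval₂_X,
    Polynomial.eval₂_C] at h
  rw [map_neg, QkRoot, ← sq]
  exact eq_neg_of_add_eq_zero_left h

/-- The central square root of `-d` in `k ⊗ F`. -/
lemma exists_central_root (a b : ℚ) : ∃ δ : Qk d ⊗[ℚ] ℍ[ℚ, a, b], (∀ x, δ * x = x * δ) ∧
    δ * δ = algebraMap ℚ _ (-d : ℚ) := by
  refine ⟨QkRoot d ⊗ₜ 1, fun x => ?_, ?_⟩
  · induction x with
    | zero => simp
    | add x y hx hy => rw [mul_add, add_mul, hx, hy]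
    | tmul x y => simp [mul_comm]
  · rw [Algebra.TensorProduct.tmul_mul_tmul, qkRoot_mul_self, mul_one,
      Algebra.TensorProduct.algebraMap_apply]

/-- The quaternion algebra `F` becomes `ℍ[K,a,b]` over any field `K` containing `√-d`. -/
lemma nonempty_algHom_tensor {K : Type*} [Field K] [Algebra ℚ K] {x : K}
    (hx : x ^ 2 = -(d : K)) (a b : ℚ) :
    Nonempty ((Qk d ⊗[ℚ] ℍ[ℚ, a, b]) →ₐ[ℚ] ℍ[K, algebraMap ℚ K a, algebraMap ℚ K b]) := by
  let f : Qk d →ₐ[ℚ] K := AdjoinRoot.liftAlgHom _ (Algebra.ofId ℚ K) x (by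
    simp [Polynomial.eval₂_add, hx])
  let g : Qk d →ₐ[ℚ] ℍ[K, algebraMap ℚ K a, algebraMap ℚ K b] :=
    ((Algebra.ofId K ℍ[K, algebraMap ℚ K a, algebraMap ℚ K b]).restrictScalars ℚ).comp f
  obtain ⟨h⟩ : Nonempty (ℍ[ℚ, a, b] →ₐ[ℚ] ℍ[K, algebraMap ℚ K a, algebraMap ℚ K b]) := by
    rw [QuatRep.nonempty_algHom_iff]
    obtain ⟨i, j, hi, hj, hij⟩ :=
      QuatRep.nonempty_algHom_iff.1 ⟨AlgHom.id K ℍ[K, algebraMap ℚ K a, algebraMap ℚ K b]⟩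
    exact ⟨i, j, by rw [hi, ← IsScalarTower.algebraMap_apply],
      by rw [hj, ← IsScalarTower.algebraMap_apply], hij⟩
  exact ⟨Algebra.TensorProduct.lift g h fun u v => Algebra.commutes (f u) (h v)⟩

/-- An embedding forces equal ramification at the primes split in `k`. -/
lemma hilbertOne_iff_of_algHom {K : Type*} [Field K] [CharZero K] [Algebra ℚ K] {x : K}
    (hx : x ^ 2 = -(d : K)) {a b a' b' : ℚ} (ha : a ≠ 0) (hb : b ≠ 0) (ha' : a' ≠ 0) (hb' : b' ≠ 0)
    (h : Nonempty (ℍ[ℚ, a', b'] →ₐ[ℚ] (Qk d ⊗[ℚ] ℍ[ℚ, a, b]))) :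
    HilbertOne K a b ↔ HilbertOne K a' b' := by
  obtain ⟨φ⟩ := h
  obtain ⟨ψ⟩ := nonempty_algHom_tensor hx a b
  obtain ⟨i, j, hi, hj, hij⟩ := QuatRep.nonempty_algHom_iff.1 ⟨ψ.comp φ⟩
  have hrep : QuatRep ℍ[K, algebraMap ℚ K a, algebraMap ℚ K b] (algebraMap ℚ K a')
      (algebraMap ℚ K b') :=
    ⟨i, j, by rw [hi, ← IsScalarTower.algebraMap_apply],
      by rw [hj, ← IsScalarTower.algebraMap_apply], hij⟩
  rw [hilbertOne_iff_isQuadNorm ha hb, hilbertOne_iff_isQuadNorm ha' hb']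
  simpa using hrep.isQuadNorm_iff (by simpa using ha) (by simpa using ha') (by simpa using hb')

/-- Equal ramification at the primes split in `k` gives an embedding. -/
lemma nonempty_algHom_of_hilbertOne_iff (hd : 1 ≤ d) {a b a' b' : ℚ} (ha : a ≠ 0) (hb : b ≠ 0)
    (ha' : a' ≠ 0) (hb' : b' ≠ 0)
    (h : ∀ (p : ℕ) [hp : Fact p.Prime], SplitsInK d p hp.out →
      (HilbertOne ℚ_[p] a b ↔ HilbertOne ℚ_[p] a' b')) :
    Nonempty (ℍ[ℚ, a', b'] →ₐ[ℚ] (Qk d ⊗[ℚ] ℍ[ℚ, a, b])) := by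
  have hD : (-d : ℤ) < 0 := by omega
  obtain ⟨δ, hδ, hδD⟩ := exists_central_root (d := d) a b
  replace hδD : δ * δ = algebraMap ℚ _ ((-d : ℤ) : ℚ) := by rw [hδD]; push_cast; rfl
  obtain ⟨A, B, hA, hB, hM, hloc⟩ := exists_int_params hD ha hb
  obtain ⟨A', B', hA', hB', hM', hloc'⟩ := exists_int_params hD ha' hb'
  rw [QuatRep.nonempty_algHom_iff, ← hM' _ δ hδ hδD]
  refine QuatRep.transfer hδ hδD hA hB hA' hB' hD (fun p => ∃ hp : p.Prime, SplitsInK d p hp)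
    ?_ ?_ ?_ ((hM _ δ hδ hδD).2 (QuatRep.nonempty_algHom_iff.1
      ⟨Algebra.TensorProduct.includeRight⟩))
  · intro p hp hP
    have : Fact p.Prime := ⟨hp⟩
    exact exists_hilbertSym_eq_neg_one hD.ne fun hsq => hP ⟨hp, splitsInK_iff_isSquare.2 hsq⟩
  · rintro p hp ⟨_, hP⟩ z hz
    have : Fact p.Prime := ⟨hp⟩
    rw [← isQuadNorm_padic_iff hD.ne hz]
    exact IsQuadNorm.of_isSquare (Int.cast_ne_zero.2 hD.ne) (splitsInK_iff_isSquare.1 hP) _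
  · rintro p hp ⟨_, hP⟩
    have : Fact p.Prime := ⟨hp⟩
    have hsq := splitsInK_iff_isSquare.1 hP
    have hiff := h p hP
    rw [hilbertOne_iff_isQuadNorm ha hb, hilbertOne_iff_isQuadNorm ha' hb', ← hloc _ hsq,
      ← hloc' _ hsq, isQuadNorm_padic_iff hA.ne' hB, isQuadNorm_padic_iff hA'.ne' hB'] at hiff
    rcases hilbertSym_eq_one_or hp hA.ne' hB with h1 | h1 <;>
      rcases hilbertSym_eq_one_or hp hA'.ne' hB' with h2 | h2 <;> rw [h1, h2] at hiff ⊢ <;>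
      norm_num at hiff

lemma Nat.eq_of_squarefree_of_prime_dvd_iff {m n : ℕ} (hm : Squarefree m) (hn : Squarefree n)
    (h : ∀ p : ℕ, p.Prime → (p ∣ m ↔ p ∣ n)) : m = n := by
  rw [← Nat.prod_primeFactors_of_squarefree hm, ← Nat.prod_primeFactors_of_squarefree hn]
  congr 1
  ext p
  simp only [Nat.mem_primeFactors, hm.ne_zero, hn.ne_zero, ne_eq, not_false_eq_true, and_true]
  exact and_congr_right fun hp => h p hp

end Embedding

/-- Lemma Item04 (ii).  Let `d ∈ ℕ` be squarefree, `k = ℚ(i√d)`,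
`F = ℍ[ℚ,a,b]` a quaternion algebra over `ℚ` and `M = k ⊗_ℚ F`.  A quaternion algebra
`E = ℍ[ℚ,a',b']` over `ℚ` embeds into `M` as a `ℚ`-algebra if and only if
`Σ_k(E) = Σ_k(F)`. -/
theorem stmt_4 (d : ℕ) (hd : Squarefree d) (hd1 : 1 ≤ d)
    (a b a' b' : ℚ) (ha : a ≠ 0) (hb : b ≠ 0) (ha' : a' ≠ 0) (hb' : b' ≠ 0)
    (skF skE : ℕ) (hF : IsSigmaK d a b skF) (hE : IsSigmaK d a' b' skE) :
    Nonempty (ℍ[ℚ, a', b'] →ₐ[ℚ] (Qk d ⊗[ℚ] ℍ[ℚ, a, b])) ↔ skE = skF := by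
  constructor
  · intro h
    refine Nat.eq_of_squarefree_of_prime_dvd_iff hE.1 hF.1 fun p hp => ?_
    have : Fact p.Prime := ⟨hp⟩
    rw [hE.2 p hp, hF.2 p hp]
    refine and_congr_left fun ⟨x, hx⟩ => not_congr ?_
    exact (hilbertOne_iff_of_algHom hx ha hb ha' hb' h).symm
  · rintro rfl
    refine nonempty_algHom_of_hilbertOne_iff hd1 ha hb ha' hb' fun p hp hs => ?_
    have h := (hF.2 p hp.out).symm.trans (hE.2 p hp.out)
    exact not_iff_not.1 ((and_iff_left hs).symm.trans (h.trans (and_iff_left hs)))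
end

section
/- Let d ∈ ℕ be squarefree, k = ℚ(i√d), E a quaternion algebra over ℚ, and p a place of ℚ that is not split in k. Then there exists τ ∈ ℤ with Hilbert symbol (τ, -d)_p = -1 such that ℚ(√τ) is a splitting field of E. -/
open scoped Quaternion Classical Polynomial TensorProduct

/-- `c` is a value of the norm form `x² - δ y²`. -/
def IsNormValue {K : Type*} [CommRing K] (δ c : K) : Prop :=
  ∃ x y : K, c = x ^ 2 - δ * y ^ 2

namespace IsNormValue

variable {K : Type*} [Field K] {δ c c' : K}

theorem mul (h : IsNormValue δ c) (h' : IsNormValue δ c') : IsNormValue δ (c * c') := by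
  obtain ⟨x, y, rfl⟩ := h
  obtain ⟨z, w, rfl⟩ := h'
  exact ⟨x * z + δ * y * w, x * w + y * z, by ring⟩

theorem sq (s : K) : IsNormValue δ (s ^ 2) := ⟨s, 0, by ring⟩

theorem of_mul_sq {s : K} (hs : s ≠ 0) (h : IsNormValue δ (c * s ^ 2)) : IsNormValue δ c := by
  have := h.mul (sq s⁻¹)
  rwa [mul_assoc, ← mul_pow, mul_inv_cancel₀ hs, one_pow, mul_one] at this

theorem of_mul_left (hc : c ≠ 0) (h : IsNormValue δ c) (h' : IsNormValue δ (c * c')) :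
    IsNormValue δ c' :=
  of_mul_sq hc (by have := h.mul h'; rwa [← mul_assoc, ← pow_two, mul_comm] at this)

theorem congr_sq {s : K} (hs : s ≠ 0) : IsNormValue (δ * s ^ 2) c ↔ IsNormValue δ c := by
  constructor
  · rintro ⟨x, y, rfl⟩
    exact ⟨x, s * y, by ring⟩
  · rintro ⟨x, y, rfl⟩
    exact ⟨x, s⁻¹ * y, by field_simp⟩

theorem neg_self : IsNormValue δ (-δ) := ⟨0, 1, by ring⟩

end IsNormValue

/-- Norm groups of quadratic extensions of `K` are maximal: the norm form of a nonsquare `δ`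
represents all values of the norm form of `α` only when `α` and `δ` agree up to squares. -/
def NormGroupsMaximal (K : Type*) [Field K] : Prop :=
  ∀ α δ : K, α ≠ 0 → δ ≠ 0 → (∀ x y : K, IsNormValue δ (x ^ 2 - α * y ^ 2)) →
    IsSquare δ ∨ IsSquare (α * δ)

theorem NormGroupsMaximal.exists_not_isNormValue {K : Type*} [Field K] [CharZero K]
    (hK : NormGroupsMaximal K) {δ a b : K} (hδ : ¬ IsSquare δ) (ha : a ≠ 0) (hb : b ≠ 0) :
    ∃ x y z : K, ¬ IsNormValue δ (a * x ^ 2 + b * y ^ 2 - a * b * z ^ 2) := by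
  by_contra! H
  have hδ0 : δ ≠ 0 := by rintro rfl; exact hδ (IsSquare.zero)
  have hNa : IsNormValue δ a := by simpa using H 1 0 0
  have hNb : IsNormValue δ b := by simpa using H 0 1 0
  obtain ⟨r, hr⟩ := (hK a δ ha hδ0 fun x y ↦ hNb.of_mul_left hb (by
    convert H 0 x y using 1; ring)).resolve_left hδ
  obtain ⟨s, hs⟩ := (hK b δ hb hδ0 fun x y ↦ hNa.of_mul_left ha (by
    convert H x 0 y using 1; ring)).resolve_left hδ
  obtain ⟨t, ht⟩ := (hK (-(a * b)) δ (by simp [ha, hb]) hδ0 fun x y ↦ hNa.of_mul_left ha (by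
    convert H x (a * y) 0 using 1; ring)).resolve_left hδ
  have hr0 : r ≠ 0 := by rintro rfl; simp [ha, hδ0] at hr
  have hs0 : s ≠ 0 := by rintro rfl; simp [hb, hδ0] at hs
  have ht0 : t ≠ 0 := by rintro rfl; simp [ha, hb, hδ0] at ht
  have ea : a = r ^ 2 / δ := by field_simp; linear_combination hr
  have eb : b = s ^ 2 / δ := by field_simp; linear_combination hs
  obtain ⟨w, hw0, hw⟩ : ∃ w, w ≠ 0 ∧ δ = -w ^ 2 := by
    refine ⟨r * s / t, by positivity, ?_⟩
    rw [ea, eb] at ht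
    field_simp at ht ⊢
    linear_combination -ht
  obtain ⟨m, n, hmn⟩ := hNa
  refine hδ ((hK 1 δ one_ne_zero hδ0 fun x y ↦ ?_).elim id (by simp))
  generalize x ^ 2 - 1 * y ^ 2 = c
  have key := H (w / r * ((1 - c) / 2)) (w / s * (w / r * m * ((1 + c) / 2)))
    (w ^ 2 / (r * s) * (w * (w / r * n) * ((1 + c) / 2)))
  convert key using 1
  have hm : -1 = (w / r * m) ^ 2 + (w * (w / r * n)) ^ 2 := by
    rw [ea, hw] at hmn
    field_simp at hmn ⊢
    linear_combination hmn
  have ea' : a = - (r / w) ^ 2 := by rw [ea, hw]; field_simp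
  have eb' : b = - (s / w) ^ 2 := by rw [eb, hw]; field_simp
  generalize w / r * m = M at *
  generalize w * (w / r * n) = N at *
  rw [ea', eb']
  field_simp
  linear_combination (-(1+c)^2) * hm

/-- If a nonzero value of the form `⟨a, b, -ab⟩` of pure quaternions becomes a square, then the
quaternion algebra `(a, b)` splits. -/
theorem hilbertOne_of_sq_eq {R : Type*} [Field R] [Algebra ℚ R] {a b x y z : ℚ}
    (ha : a ≠ 0) (hb : b ≠ 0) {θ : R} (hθ0 : θ ≠ 0)
    (hθ : θ ^ 2 = algebraMap ℚ R (a * x ^ 2 + b * y ^ 2 - a * b * z ^ 2)) :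
    HilbertOne R a b := by
  have : CharZero R := algebraRat.charZero R
  unfold HilbertOne
  simp only [map_sub, map_add, map_mul, map_pow] at hθ
  have ha' : algebraMap ℚ R a ≠ 0 := by simpa using ha
  have hb' : algebraMap ℚ R b ≠ 0 := by simpa using hb
  generalize algebraMap ℚ R a = A at *
  generalize algebraMap ℚ R b = B at *
  generalize algebraMap ℚ R x = X at *
  generalize algebraMap ℚ R y = Y at *
  generalize algebraMap ℚ R z = Z at *
  by_cases hD : Y ^ 2 - A * Z ^ 2 = 0
  · have hX : θ ^ 2 = A * X ^ 2 := by linear_combination hθ + B * hD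
    by_cases hZ : Z = 0
    · have hX0 : X ≠ 0 := by rintro rfl; simp [hθ0] at hX
      exact ⟨X / θ, 0, by field_simp; linear_combination -hX⟩
    · have hY0 : Y ≠ 0 := by rintro rfl; simp [ha', hZ] at hD
      exact ⟨Z / Y, 0, by field_simp; linear_combination -hD⟩
  · obtain ⟨s, t, hst⟩ : ∃ s t : R, B = s ^ 2 - A * t ^ 2 :=
      ⟨(θ * Y - A * X * Z) / (Y ^ 2 - A * Z ^ 2), (X * Y - θ * Z) / (Y ^ 2 - A * Z ^ 2), by
        field_simp
        linear_combination (-(Y ^ 2 - A * Z ^ 2)) * hθ⟩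
    by_cases hs : s = 0
    · subst hs
      have ht : t ≠ 0 := by rintro rfl; simp at hst; exact hb' hst
      refine ⟨(1 + 1 / A) / 2, (1 - 1 / A) / (2 * t), ?_⟩
      rw [hst]
      field_simp
      ring
    · exact ⟨t / s, 1 / s, by field_simp; linear_combination hst⟩

/-- Over a complete field with dense `ℚ`, the pure quaternions whose square is not a norm
may be taken rational. -/
theorem NormGroupsMaximal.exists_rat_not_isNormValue {K : Type*} [NontriviallyNormedField K]
    [CompleteSpace K] [CharZero K] (hK : NormGroupsMaximal K)
    (hdense : DenseRange ((↑) : ℚ → K)) {δ : K} (hδ : ¬ IsSquare δ) {a b : ℚ}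
    (ha : a ≠ 0) (hb : b ≠ 0) :
    ∃ x y z : ℚ, ¬ IsNormValue δ ((a * x ^ 2 + b * y ^ 2 - a * b * z ^ 2 : ℚ) : K) := by
  obtain ⟨x, y, z, h⟩ := hK.exists_not_isNormValue hδ (a := (a : K)) (b := (b : K))
    (by exact_mod_cast ha) (by exact_mod_cast hb)
  set q : K × K × K → K := fun v ↦ a * v.1 ^ 2 + b * v.2.1 ^ 2 - a * b * v.2.2 ^ 2 with hq
  have hqc : Continuous q := by fun_prop
  set t := q (x, y, z) with ht
  have ht0 : t ≠ 0 := by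
    intro h0
    refine h ⟨0, 0, ?_⟩
    simpa [hq] using ht.symm.trans h0
  have hsq : ∀ᶠ u in nhds (1 : K), IsSquare u := by
    have hd : HasStrictDerivAt (fun u : K ↦ u ^ 2) 2 1 := by
      simpa using hasStrictDerivAt_pow 2 (1 : K)
    have := hd.map_nhds_eq two_ne_zero
    rw [one_pow] at this
    rw [← this, Filter.eventually_map]
    exact Filter.Eventually.of_forall fun u ↦ IsSquare.sq u
  have hlim : Filter.Tendsto (fun v ↦ q v / t) (nhds (x, y, z)) (nhds 1) := by
    have := (hqc.div_const t).tendsto (x, y, z)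
    rwa [← ht, div_self ht0] at this
  obtain ⟨U, hU, hUo, hxU⟩ := mem_nhds_iff.1
    ((hlim.eventually hsq).and (hlim.eventually_ne one_ne_zero))
  obtain ⟨⟨x', y', z'⟩, hv⟩ :=
    (hdense.prodMap (hdense.prodMap hdense)).exists_mem_open hUo ⟨_, hxU⟩
  obtain ⟨⟨s, hs⟩, hne⟩ := hU hv
  simp only [Prod.map_apply] at hs hne
  refine ⟨x', y', z', fun hN ↦ h ?_⟩
  have hs0 : s ≠ 0 := by rintro rfl; simp_all
  refine IsNormValue.of_mul_sq hs0 ?_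
  convert hN using 1
  change t * s ^ 2 = _
  rw [pow_two, ← hs]
  field_simp
  simp [hq]

theorem exists_splitting_of_normGroupsMaximal {K : Type*} [NontriviallyNormedField K]
    [CompleteSpace K] [CharZero K] [Algebra ℚ K] (hK : NormGroupsMaximal K)
    (hdense : DenseRange ((↑) : ℚ → K)) {δ a b : ℚ} (hδ : ¬ IsSquare (δ : K))
    (ha : a ≠ 0) (hb : b ≠ 0) :
    ∃ τ : ℤ, τ ≠ 0 ∧ ¬ HilbertOne K (τ : ℚ) δ ∧
      HilbertOne (AdjoinRoot ((Polynomial.X : ℚ[X]) ^ 2 - Polynomial.C (τ : ℚ))) a b := by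
  obtain ⟨x, y, z, h⟩ := hK.exists_rat_not_isNormValue hdense hδ ha hb
  set t : ℚ := a * x ^ 2 + b * y ^ 2 - a * b * z ^ 2 with ht
  have hden : (t.den : ℚ) ≠ 0 := by exact_mod_cast t.den_ne_zero
  have hτ : ((t.num * t.den : ℤ) : ℚ) = t * t.den ^ 2 := by
    push_cast
    nth_rewrite 3 [← Rat.num_div_den t]
    field_simp
  have hN : ¬ IsNormValue (δ : K) (((t.num * t.den : ℤ) : ℚ) : K) := by
    rw [hτ]
    push_cast
    exact fun hN ↦ h (IsNormValue.of_mul_sq (by exact_mod_cast hden) hN)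
  generalize t.num * t.den = τ at *
  have hτ0 : τ ≠ 0 := by
    rintro rfl
    exact hN ⟨0, 0, by simp⟩
  refine ⟨τ, hτ0, ?_, ?_⟩
  · rintro ⟨u, w, huw⟩
    simp only [eq_ratCast] at huw
    by_cases hu : u = 0
    · subst hu
      have hw : w ≠ 0 := by rintro rfl; simp at huw
      exact hδ ⟨1 / w, by field_simp; linear_combination huw⟩
    · exact hN ⟨1 / u, w / u, by field_simp; linear_combination huw⟩
  · have hirr : Irreducible ((Polynomial.X : ℚ[X]) ^ 2 - Polynomial.C (τ : ℚ)) := by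
      refine X_pow_sub_C_irreducible_of_prime Nat.prime_two fun r hr ↦ hN ⟨r, 0, ?_⟩
      rw [← hr]
      push_cast
      ring
    have : Fact (Irreducible ((Polynomial.X : ℚ[X]) ^ 2 - Polynomial.C (τ : ℚ))) := ⟨hirr⟩
    have hroot : (AdjoinRoot.root ((Polynomial.X : ℚ[X]) ^ 2 - Polynomial.C (τ : ℚ))) ^ 2 =
        algebraMap ℚ _ (τ : ℚ) := by
      have := AdjoinRoot.eval₂_root ((Polynomial.X : ℚ[X]) ^ 2 - Polynomial.C (τ : ℚ))
      simp only [Polynomial.eval₂_sub, Polynomial.eval₂_pow, Polynomial.eval₂_X,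
        Polynomial.eval₂_C] at this
      exact sub_eq_zero.1 this
    refine hilbertOne_of_sq_eq (x := x * t.den) (y := y * t.den) (z := z * t.den) ha hb
      (θ := AdjoinRoot.root _) ?_ ?_
    · intro h0
      rw [h0, zero_pow two_ne_zero, eq_comm, map_eq_zero] at hroot
      exact hτ0 (by exact_mod_cast hroot)
    · rw [hroot]
      exact congrArg _ (hτ.trans (by rw [ht]; ring))

theorem normGroupsMaximal_real : NormGroupsMaximal ℝ := by
  intro α δ hα hδ h
  by_cases hδ' : 0 ≤ δ
  · exact Or.inl (Real.isSquare_iff.2 hδ')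
  · push Not at hδ'
    obtain ⟨x, y, hxy⟩ := h 0 1
    exact Or.inr (Real.isSquare_iff.2 (by
      nlinarith [sq_nonneg x, mul_nonneg (neg_nonneg.2 hδ'.le) (sq_nonneg y)]))

/-- Modulo `16`, the equation `c Z² = X² - δ Y²` has only solutions in even numbers; the list
consists of the squares. -/
def normObstruction (c δ : ZMod 16) : Bool :=
  [0, 1, 4, 9].all fun X ↦ [0, 1, 4, 9].all fun Y ↦ [0, 1, 4, 9].all fun Z ↦
    !(c * Z == X - δ * Y) || (4 * X == 0 && 4 * Y == 0 && 4 * Z == 0)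

theorem exists_normObstruction :
    ∀ α δ : ZMod 16, (4 * α == 0 || 4 * δ == 0 || δ == 1 || δ == 9 || α == δ ||
      (8 * α == 8 && α == δ + 8)) = true ∨ ∃ x y : ZMod 16,
        normObstruction (x ^ 2 - α * y ^ 2) δ = true := by
  decide +kernel

theorem even_of_normObstruction {c δ x y z : ZMod 16} (h : normObstruction c δ = true)
    (hc : c * z ^ 2 = x ^ 2 - δ * y ^ 2) : 4 * x ^ 2 = 0 ∧ 4 * y ^ 2 = 0 ∧ 4 * z ^ 2 = 0 := by
  have hsq : ∀ u : ZMod 16, u ^ 2 ∈ [0, 1, 4, 9] := by decide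
  have := List.all_eq_true.1 (List.all_eq_true.1 (List.all_eq_true.1 h _ (hsq x)) _ (hsq y)) _
    (hsq z)
  simpa [hc, and_assoc] using this

section Padic

variable {p : ℕ} [Fact p.Prime]

theorem PadicInt.isSquare_of_norm_lt {a c : ℤ_[p]} (h : ‖a ^ 2 - c‖ < ‖2 * a‖ ^ 2) :
    IsSquare c := by
  have := hensels_lemma (p := p) (R := ℤ_[p]) (F := Polynomial.X ^ 2 - Polynomial.C c) (a := a)
    (by simpa [one_add_one_eq_two] using h)
  obtain ⟨z, hz, -⟩ := this
  simp only [map_sub, map_pow, Polynomial.aeval_X, Polynomial.aeval_C] at hz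
  exact ⟨z, by rw [← pow_two]; exact (sub_eq_zero.1 hz).symm⟩

theorem PadicInt.exists_primitive_of_isNormValue {c δ : ℤ_[p]}
    (h : IsNormValue (δ : ℚ_[p]) (c : ℚ_[p])) :
    ∃ x y z : ℤ_[p], c * z ^ 2 = x ^ 2 - δ * y ^ 2 ∧ (IsUnit x ∨ IsUnit y ∨ IsUnit z) := by
  obtain ⟨x, y, h⟩ := h
  obtain ⟨m, hm0, hx, hy, h1, hm⟩ : ∃ m : ℚ_[p], m ≠ 0 ∧ ‖x‖ ≤ ‖m‖ ∧ ‖y‖ ≤ ‖m‖ ∧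
      ‖(1 : ℚ_[p])‖ ≤ ‖m‖ ∧ (m = x ∨ m = y ∨ m = 1) := by
    have aux : ∀ m : ℚ_[p], ‖(1 : ℚ_[p])‖ ≤ ‖m‖ → m ≠ 0 := by
      rintro m hm rfl
      simp at hm
      linarith
    by_cases hxy : ‖x‖ ≤ ‖y‖
    · rcases le_total ‖y‖ ‖(1 : ℚ_[p])‖ with hy | hy
      · exact ⟨1, one_ne_zero, hxy.trans hy, hy, le_rfl, by simp⟩
      · exact ⟨y, aux _ hy, hxy, le_rfl, hy, by simp⟩
    · rcases le_total ‖x‖ ‖(1 : ℚ_[p])‖ with hx | hx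
      · exact ⟨1, one_ne_zero, hx, (le_of_not_ge hxy).trans hx, le_rfl, by simp⟩
      · exact ⟨x, aux _ hx, le_rfl, le_of_not_ge hxy, hx, by simp⟩
  have hdiv : ∀ w : ℚ_[p], ‖w‖ ≤ ‖m‖ → ∃ w' : ℤ_[p], (w' : ℚ_[p]) = w / m := fun w hw ↦
    ⟨⟨w / m, by rw [norm_div]; exact div_le_one_of_le₀ hw (norm_nonneg _)⟩, rfl⟩
  obtain ⟨x', hx'⟩ := hdiv _ hx
  obtain ⟨y', hy'⟩ := hdiv _ hy
  obtain ⟨z', hz'⟩ := hdiv _ h1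
  refine ⟨x', y', z', ?_, ?_⟩
  · refine Subtype.coe_injective ?_
    push_cast
    rw [hx', hy', hz']
    field_simp
    exact h
  · simp only [PadicInt.isUnit_iff, PadicInt.norm_def, hx', hy', hz', norm_div]
    have hm0' : ‖m‖ ≠ 0 := norm_ne_zero_iff.2 hm0
    rcases hm with rfl | rfl | rfl
    · exact Or.inl (div_self hm0')
    · exact Or.inr (Or.inl (div_self hm0'))
    · exact Or.inr (Or.inr (div_self hm0'))

/-- `c` is a unit or `p` times a unit. -/
def PadicInt.IsReduced (c : ℤ_[p]) : Prop := IsUnit c ∨ ∃ u : ℤ_[p], IsUnit u ∧ c = p * u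

theorem PadicInt.exists_isReduced {c : ℚ_[p]} (hc : c ≠ 0) :
    ∃ (s : ℚ_[p]) (c' : ℤ_[p]), s ≠ 0 ∧ c'.IsReduced ∧ c = c' * s ^ 2 := by
  have hp0 : (p : ℚ_[p]) ≠ 0 := by exact_mod_cast (Fact.out : p.Prime).ne_zero
  have hp0' : (p : ℝ) ≠ 0 := by exact_mod_cast (Fact.out : p.Prime).ne_zero
  have hu : ‖c * (p : ℚ_[p]) ^ (-c.valuation)‖ = 1 := by
    rw [norm_mul, Padic.norm_eq_zpow_neg_valuation hc, Padic.norm_p_zpow, ← zpow_add₀ hp0']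
    simp
  set u : ℤ_[p] := ⟨_, hu.le⟩ with hudef
  have hunit : IsUnit u := PadicInt.isUnit_iff.2 hu
  have hcu : c = u * (p : ℚ_[p]) ^ c.valuation := by
    rw [hudef, mul_assoc, ← zpow_add₀ hp0]; simp
  rcases Int.even_or_odd' c.valuation with ⟨k, hk | hk⟩
  · refine ⟨p ^ k, u, zpow_ne_zero _ hp0, Or.inl hunit, ?_⟩
    rw [hcu, hk, pow_two, ← zpow_add₀ hp0, two_mul]
  · refine ⟨p ^ k, p * u, zpow_ne_zero _ hp0, Or.inr ⟨u, hunit, rfl⟩, ?_⟩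
    rw [hcu, hk, pow_two, ← zpow_add₀ hp0, two_mul, zpow_add_one₀ hp0]
    push_cast
    ring

theorem normGroupsMaximal_padic_of_isReduced
    (H : ∀ α δ : ℤ_[p], α.IsReduced → δ.IsReduced →
      (∀ x y : ℚ_[p], IsNormValue (δ : ℚ_[p]) (x ^ 2 - α * y ^ 2)) →
      IsSquare (δ : ℚ_[p]) ∨ IsSquare (α * δ : ℚ_[p])) :
    NormGroupsMaximal ℚ_[p] := by
  intro α δ hα hδ h
  obtain ⟨s, α', hs, hα', rfl⟩ := PadicInt.exists_isReduced hα
  obtain ⟨t, δ', ht, hδ', rfl⟩ := PadicInt.exists_isReduced hδ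
  refine (H α' δ' hα' hδ' fun x y ↦ ?_).imp (fun h ↦ h.mul (IsSquare.sq t)) fun h ↦ ?_
  · rw [← IsNormValue.congr_sq ht]
    convert h x (y / s) using 1
    field_simp
  · rw [show (α' : ℚ_[p]) * s ^ 2 * (δ' * t ^ 2) = α' * δ' * (s * t) ^ 2 by ring]
    exact h.mul (IsSquare.sq (s * t))

theorem PadicInt.toZMod_eq_zero_iff {c : ℤ_[p]} : c.toZMod = 0 ↔ (p : ℤ_[p]) ∣ c := by
  rw [← RingHom.mem_ker, PadicInt.ker_toZMod, PadicInt.maximalIdeal_eq_span_p,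
    Ideal.mem_span_singleton]

theorem PadicInt.isUnit_iff_toZMod_ne_zero {c : ℤ_[p]} : IsUnit c ↔ c.toZMod ≠ 0 := by
  rw [Ne, PadicInt.toZMod_eq_zero_iff, ← PadicInt.norm_lt_one_iff_dvd, ← PadicInt.not_isUnit_iff,
    not_not]

theorem PadicInt.isSquare_of_isSquare_toZMod (hp : p ≠ 2) {c : ℤ_[p]} (hc : IsUnit c)
    (h : IsSquare c.toZMod) : IsSquare c := by
  obtain ⟨w, hw⟩ := h
  obtain ⟨a, rfl⟩ := ZMod.ringHom_surjective PadicInt.toZMod w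
  have ha : IsUnit a := by
    rw [PadicInt.isUnit_iff_toZMod_ne_zero] at hc ⊢
    rintro h0
    simp [h0] at hw
    exact hc hw
  have h2 : IsUnit (2 : ℤ_[p]) := by
    rw [PadicInt.isUnit_iff, ← Nat.cast_ofNat, PadicInt.norm_natCast_eq_one_iff]
    exact (Nat.coprime_primes Fact.out Nat.prime_two).2 hp
  refine PadicInt.isSquare_of_norm_lt (a := a) ?_
  rw [PadicInt.isUnit_iff.1 (h2.mul ha), one_pow, PadicInt.norm_lt_one_iff_dvd,
    ← PadicInt.toZMod_eq_zero_iff]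
  simp [hw, pow_two]

theorem ZMod.isSquare_mul_of_not_isSquare {a b : ZMod p} (ha : ¬ IsSquare a)
    (hb : ¬ IsSquare b) : IsSquare (a * b) := by
  have ha0 : a ≠ 0 := by rintro rfl; exact ha IsSquare.zero
  have hb0 : b ≠ 0 := by rintro rfl; exact hb IsSquare.zero
  rw [← quadraticChar_one_iff_isSquare (mul_ne_zero ha0 hb0), map_mul,
    quadraticChar_neg_one_iff_not_isSquare.2 ha, quadraticChar_neg_one_iff_not_isSquare.2 hb]
  norm_num

theorem PadicInt.not_isNormValue_p_mul {u δ : ℤ_[p]} (hu : IsUnit u)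
    (hδ : ¬ IsSquare δ.toZMod) :
    ¬ IsNormValue (δ : ℚ_[p]) ((p * u : ℤ_[p]) : ℚ_[p]) := by
  intro h
  obtain ⟨x, y, z, h, hprim⟩ := PadicInt.exists_primitive_of_isNormValue h
  have hmod := congrArg PadicInt.toZMod h
  simp only [map_mul, map_natCast, CharP.cast_eq_zero, zero_mul, map_sub, map_pow] at hmod
  have hy : y.toZMod = 0 := by
    by_contra hy
    exact hδ ⟨x.toZMod / y.toZMod, by field_simp; linear_combination hmod⟩
  have hx : x.toZMod = 0 := by
    rw [hy] at hmod
    simpa using hmod.symm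
  have hz : z.toZMod = 0 := by
    obtain ⟨x', rfl⟩ := PadicInt.toZMod_eq_zero_iff.1 hx
    obtain ⟨y', rfl⟩ := PadicInt.toZMod_eq_zero_iff.1 hy
    have h' : u * z ^ 2 = p * (x' ^ 2 - δ * y' ^ 2) :=
      mul_left_cancel₀ PadicInt.prime_p.ne_zero (by linear_combination h)
    have hmod' := congrArg PadicInt.toZMod h'
    simpa [PadicInt.isUnit_iff_toZMod_ne_zero.1 hu] using hmod'
  simp [PadicInt.isUnit_iff_toZMod_ne_zero, hx, hy, hz] at hprim

theorem PadicInt.isSquare_toZMod_of_isNormValue {u e : ℤ_[p]} (he : IsUnit e)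
    (h : IsNormValue ((p * e : ℤ_[p]) : ℚ_[p]) (u : ℚ_[p])) : IsSquare u.toZMod := by
  by_contra hu
  obtain ⟨x, y, z, h, hprim⟩ := PadicInt.exists_primitive_of_isNormValue h
  have hmod := congrArg PadicInt.toZMod h
  simp only [map_mul, map_natCast, CharP.cast_eq_zero, zero_mul, map_sub, map_pow,
    sub_zero] at hmod
  have hz : z.toZMod = 0 := by
    by_contra hz
    exact hu ⟨x.toZMod / z.toZMod, by field_simp; linear_combination hmod⟩
  have hx : x.toZMod = 0 := by
    rw [hz] at hmod
    simpa using hmod.symm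
  have hy : y.toZMod = 0 := by
    obtain ⟨x', rfl⟩ := PadicInt.toZMod_eq_zero_iff.1 hx
    obtain ⟨z', rfl⟩ := PadicInt.toZMod_eq_zero_iff.1 hz
    have h' : e * y ^ 2 = p * (x' ^ 2 - u * z' ^ 2) :=
      mul_left_cancel₀ PadicInt.prime_p.ne_zero (by linear_combination h)
    have hmod' := congrArg PadicInt.toZMod h'
    simpa [PadicInt.isUnit_iff_toZMod_ne_zero.1 he] using hmod'
  simp [PadicInt.isUnit_iff_toZMod_ne_zero, hx, hy, hz] at hprim

theorem PadicInt.isSquare_coe {c : ℤ_[p]} (h : IsSquare c) : IsSquare (c : ℚ_[p]) :=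
  h.map PadicInt.Coe.ringHom

theorem ZMod.exists_sq_sub_mul_sq (hp : p ≠ 2) {a : ZMod p} (ha : a ≠ 0) (w : ZMod p) :
    ∃ x y : ZMod p, x ^ 2 - a * y ^ 2 = w := by
  obtain ⟨x, y, h⟩ := FiniteField.exists_root_sum_quadratic
    (f := (Polynomial.X : (ZMod p)[X]) ^ 2)
    (g := Polynomial.C (-a) * Polynomial.X ^ 2 + Polynomial.C 0 * Polynomial.X + Polynomial.C (-w))
    (Polynomial.degree_X_pow 2) (Polynomial.degree_quadratic (neg_ne_zero.2 ha))
    (by rw [ZMod.card]; exact (Fact.out : p.Prime).eq_two_or_odd.resolve_left hp)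
  refine ⟨x, y, ?_⟩
  simp at h
  linear_combination h

theorem normGroupsMaximal_padic_of_ne_two (hp : p ≠ 2) : NormGroupsMaximal ℚ_[p] := by
  refine normGroupsMaximal_padic_of_isReduced fun α δ hα hδ h ↦ ?_
  rw [or_iff_not_imp_left]
  intro hns
  have hp0 : (p : ℚ_[p]) ≠ 0 := by exact_mod_cast (Fact.out : p.Prime).ne_zero
  have hnα : IsNormValue (δ : ℚ_[p]) (-α : ℚ_[p]) := by simpa using h 0 1
  rcases hδ with hδ | ⟨e, he, rfl⟩
  · have hns' : ¬ IsSquare δ.toZMod := fun h' ↦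
      hns (PadicInt.isSquare_coe (PadicInt.isSquare_of_isSquare_toZMod hp hδ h'))
    rcases hα with hα | ⟨u, hu, rfl⟩
    · rw [← PadicInt.coe_mul]
      refine PadicInt.isSquare_coe (PadicInt.isSquare_of_isSquare_toZMod hp (hα.mul hδ) ?_)
      rw [map_mul]
      refine ZMod.isSquare_mul_of_not_isSquare (fun hαsq ↦ ?_) hns'
      obtain ⟨r, rfl⟩ := PadicInt.isSquare_of_isSquare_toZMod hp hα hαsq
      have hr : (r : ℚ_[p]) ≠ 0 := by
        intro h0
        rw [PadicInt.coe_eq_zero.1 h0] at hα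
        simp at hα
      refine PadicInt.not_isNormValue_p_mul isUnit_one hns' ?_
      convert h ((1 + p) / 2) ((1 - p) / (2 * r)) using 1
      push_cast
      field_simp
      ring
    · refine absurd ?_ (PadicInt.not_isNormValue_p_mul hu.neg hns')
      convert hnα using 1
      push_cast
      ring
  · rcases hα with hα | ⟨u, hu, rfl⟩
    · exfalso
      obtain ⟨w, hw⟩ := FiniteField.exists_nonsquare (F := ZMod p) (by rwa [ZMod.ringChar_zmod_n])
      obtain ⟨x, y, hxy⟩ := ZMod.exists_sq_sub_mul_sq hp
        (PadicInt.isUnit_iff_toZMod_ne_zero.1 hα) w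
      obtain ⟨x, rfl⟩ := ZMod.ringHom_surjective PadicInt.toZMod x
      obtain ⟨y, rfl⟩ := ZMod.ringHom_surjective PadicInt.toZMod y
      rw [← hxy, ← map_pow, ← map_pow, ← map_mul, ← map_sub] at hw
      exact hw (PadicInt.isSquare_toZMod_of_isNormValue he (by exact_mod_cast h x y))
    · have hue : IsNormValue ((p * e : ℤ_[p]) : ℚ_[p]) ((u * e : ℤ_[p]) : ℚ_[p]) := by
        refine IsNormValue.of_mul_sq hp0 ?_
        convert hnα.mul IsNormValue.neg_self using 1
        push_cast
        ring
      have := PadicInt.isSquare_coe (PadicInt.isSquare_of_isSquare_toZMod hp (hu.mul he)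
        (PadicInt.isSquare_toZMod_of_isNormValue he hue))
      rw [show ((p * u : ℤ_[p]) * (p * e : ℤ_[p]) : ℚ_[p]) = (u * e : ℤ_[p]) * (p : ℚ_[p]) ^ 2 by
        push_cast; ring]
      exact this.mul (IsSquare.sq (p : ℚ_[p]))

end Padic

theorem PadicInt.toZModPow_eq_zero_iff {p : ℕ} [Fact p.Prime] {n : ℕ} {c : ℤ_[p]} :
    c.toZModPow n = 0 ↔ (p : ℤ_[p]) ^ n ∣ c := by
  rw [← RingHom.mem_ker, PadicInt.ker_toZModPow, Ideal.mem_span_singleton]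

theorem PadicInt.isSquare_of_eight_dvd {c : ℤ_[2]} (h : 8 ∣ c - 1) : IsSquare c := by
  refine PadicInt.isSquare_of_norm_lt (a := 1) ?_
  have h2 : ‖(2 : ℤ_[2])‖ = 2⁻¹ := by simpa using PadicInt.norm_p (p := 2)
  obtain ⟨k, hk⟩ := h
  have : (1 : ℤ_[2]) ^ 2 - c = 2 ^ 3 * (-k) := by linear_combination -hk
  rw [this, mul_one, norm_mul, norm_pow, h2]
  have := PadicInt.norm_le_one (-k)
  nlinarith [norm_nonneg (-k)]

/-- The square of a unit of `ℤ₂` is congruent to `1` modulo `8`. -/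
theorem PadicInt.eight_dvd_sq_sub_one {u : ℤ_[2]} (hu : IsUnit u) : 8 ∣ u ^ 2 - 1 := by
  have h8 : (8 : ℤ_[2]) = ((2 : ℕ) : ℤ_[2]) ^ 3 := by norm_num
  have hu' := hu.map (PadicInt.toZModPow (p := 2) 3)
  rw [h8, ← PadicInt.toZModPow_eq_zero_iff, map_sub, map_pow, map_one]
  revert hu'
  generalize PadicInt.toZModPow 3 u = w
  revert w
  change ∀ w : ZMod 8, IsUnit w → w ^ 2 - 1 = 0
  intro w hw
  obtain ⟨w, rfl⟩ := hw
  revert w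
  decide

theorem PadicInt.IsReduced.not_four_dvd {c : ℤ_[2]} (hc : c.IsReduced) : ¬ 4 ∣ c := by
  have hp := PadicInt.prime_p (p := 2)
  rintro ⟨k, hk⟩
  rcases hc with hc | ⟨u, hu, rfl⟩
  · exact hp.not_isUnit (isUnit_of_dvd_unit ⟨2 * k, by rw [hk]; push_cast; ring⟩ hc)
  · refine hp.not_isUnit (isUnit_of_dvd_unit ⟨k, ?_⟩ hu)
    refine mul_left_cancel₀ hp.ne_zero (hk.trans ?_)
    push_cast
    ring

theorem PadicInt.IsReduced.isSquare_mul {α δ : ℤ_[2]} (hα : α.IsReduced) (hδ : δ.IsReduced)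
    (h : 16 ∣ α - δ ∨ IsUnit α ∧ 8 ∣ α - δ) : IsSquare (α * δ) := by
  have hp : Prime (2 : ℤ_[2]) := by exact_mod_cast PadicInt.prime_p (p := 2)
  have hdvd : 2 ∣ α - δ := by
    rcases h with h | ⟨-, h⟩
    · exact (Dvd.intro 8 (by norm_num)).trans h
    · exact (Dvd.intro 4 (by norm_num)).trans h
  have key : ∀ u v : ℤ_[2], IsUnit u → 8 ∣ u - v → IsSquare (u * v) := fun u v hu huv ↦ by
    refine PadicInt.isSquare_of_eight_dvd ?_
    have := (PadicInt.eight_dvd_sq_sub_one hu).sub (huv.mul_left u)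
    convert this using 1
    ring
  have hunit : ∀ u : ℤ_[2], IsUnit u → ¬ 2 ∣ u := fun u hu h2 ↦
    hp.not_isUnit (isUnit_of_dvd_unit h2 hu)
  rcases hα with hα | ⟨u, hu, rfl⟩
  · refine key α δ hα ?_
    rcases h with h | ⟨-, h⟩
    · exact (Dvd.intro 2 (by norm_num)).trans h
    · exact h
  · have h2u : (2 : ℤ_[2]) ∣ (2 : ℕ) * u := ⟨u, by norm_num⟩
    rcases hδ with hδ | ⟨v, hv, rfl⟩
    · exact absurd ((dvd_sub_right h2u).1 hdvd) (hunit _ hδ)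
    · rcases h with ⟨k, hk⟩ | ⟨h, -⟩
      · obtain ⟨r, hr⟩ := key u v hu ⟨k, mul_left_cancel₀ hp.ne_zero (by
          push_cast at hk; linear_combination hk)⟩
        exact ⟨2 * r, by push_cast; linear_combination 4 * hr⟩
      · exact absurd h2u (hunit _ h)

theorem normGroupsMaximal_padic_two : NormGroupsMaximal ℚ_[2] := by
  refine normGroupsMaximal_padic_of_isReduced fun α δ hα hδ h ↦ ?_
  obtain ⟨f, hf⟩ : ∃ f : ℤ_[2] →+* ZMod 16, ∀ c, f c = 0 ↔ 16 ∣ c :=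
    ⟨PadicInt.toZModPow 4, fun c ↦ by
      rw [show (16 : ℤ_[2]) = ((2 : ℕ) : ℤ_[2]) ^ 4 by norm_num]
      exact PadicInt.toZModPow_eq_zero_iff⟩
  have hf4 : ∀ c, 4 * f c = 0 → 4 ∣ c := fun c hc ↦ by
    obtain ⟨k, hk⟩ := (hf (4 * c)).1 (by rwa [map_mul, map_ofNat])
    exact ⟨k, mul_left_cancel₀ (OfNat.ofNat_ne_zero 4 : (4 : ℤ_[2]) ≠ 0) (by linear_combination hk)⟩
  have hf8 : ∀ c, 2 * f c = 0 → 8 ∣ c := fun c hc ↦ by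
    obtain ⟨k, hk⟩ := (hf (2 * c)).1 (by rwa [map_mul, map_ofNat])
    exact ⟨k, mul_left_cancel₀ (two_ne_zero' ℤ_[2]) (by linear_combination hk)⟩
  rcases exists_normObstruction (f α) (f δ) with hspecial | ⟨x, y, hxy⟩
  · simp only [Bool.or_eq_true, Bool.and_eq_true, beq_iff_eq] at hspecial
    rcases hspecial with ((((hs | hs) | hs) | hs) | hs) | ⟨hs, hs'⟩
    · exact absurd (hf4 _ hs) hα.not_four_dvd
    · exact absurd (hf4 _ hs) hδ.not_four_dvd
    · exact Or.inl (PadicInt.isSquare_coe (PadicInt.isSquare_of_eight_dvd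
        (hf8 _ (by rw [map_sub, map_one, hs]; decide))))
    · exact Or.inl (PadicInt.isSquare_coe (PadicInt.isSquare_of_eight_dvd
        (hf8 _ (by rw [map_sub, map_one, hs]; decide))))
    · right
      rw [← PadicInt.coe_mul]
      exact PadicInt.isSquare_coe
        (hα.isSquare_mul hδ (Or.inl ((hf _).1 (by rw [map_sub, hs, sub_self]))))
    · right
      rw [← PadicInt.coe_mul]
      refine PadicInt.isSquare_coe (hα.isSquare_mul hδ (Or.inr ⟨?_, hf8 _ ?_⟩))
      · rcases hα with hα | ⟨u, hu, rfl⟩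
        · exact hα
        · rw [map_mul, map_natCast] at hs
          generalize f u = w at hs
          exfalso
          revert w
          decide
      · rw [map_sub, hs', add_sub_cancel_left]
        decide
  · exfalso
    obtain ⟨x, rfl⟩ := ZMod.ringHom_surjective f x
    obtain ⟨y, rfl⟩ := ZMod.ringHom_surjective f y
    obtain ⟨X, Y, Z, hXYZ, hprim⟩ := PadicInt.exists_primitive_of_isNormValue
      (c := x ^ 2 - α * y ^ 2) (δ := δ) (by exact_mod_cast h x y)
    have hmod := congrArg f hXYZ
    simp only [map_mul, map_sub, map_pow] at hmod
    obtain ⟨hX, hY, hZ⟩ := even_of_normObstruction hxy hmod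
    have hnu : ∀ c, 4 * f c ^ 2 = 0 → ¬ IsUnit c := fun c hc hu ↦ by
      have h4 := hf4 (c ^ 2) (by simpa using hc)
      exact PadicInt.IsReduced.not_four_dvd (Or.inl (hu.pow 2)) h4
    rcases hprim with hu | hu | hu
    · exact hnu _ hX hu
    · exact hnu _ hY hu
    · exact hnu _ hZ hu

theorem normGroupsMaximal_padic (p : ℕ) [Fact p.Prime] : NormGroupsMaximal ℚ_[p] := by
  by_cases hp : p = 2
  · subst hp
    exact normGroupsMaximal_padic_two
  · exact normGroupsMaximal_padic_of_ne_two hp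

/-- Lemma Item05.  Let `d ∈ ℕ` be squarefree, `k = ℚ(i√d)`,
`E = ℍ[ℚ,a,b]` a quaternion algebra over `ℚ`, and `v` a place of `ℚ` that is not split
in `k`.  Then there is a `τ ∈ ℤ` with Hilbert symbol `(τ,-d)_v = -1` such that
`ℚ(√τ) = ℚ[X]/(X²-τ)` is a splitting field of `E`. -/
theorem stmt_5 (d : ℕ) (hd : Squarefree d) (hd1 : 1 ≤ d)
    (a b : ℚ) (ha : a ≠ 0) (hb : b ≠ 0)
    (v : QPlace) (hv : ¬ v.SplitsK d) :
    ∃ τ : ℤ, τ ≠ 0 ∧ ¬ v.Hone (τ : ℚ) (-(d : ℚ)) ∧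
      HilbertOne (AdjoinRoot ((Polynomial.X : ℚ[X]) ^ 2 - Polynomial.C (τ : ℚ))) a b := by
  cases v with
  | fin p hp =>
    have : Fact p.Prime := ⟨hp⟩
    refine exists_splitting_of_normGroupsMaximal (K := ℚ_[p]) (normGroupsMaximal_padic p)
      (Padic.denseRange_ratCast p) (δ := -(d : ℚ)) (fun ⟨r, hr⟩ ↦ hv ⟨r, ?_⟩) ha hb
    rw [pow_two, ← hr]
    push_cast
    rfl
  | inf =>
    refine exists_splitting_of_normGroupsMaximal (K := ℝ) normGroupsMaximal_real
      Rat.denseRange_cast (δ := -(d : ℚ)) (fun h ↦ ?_) ha hb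
    rw [Real.isSquare_iff] at h
    have : (1 : ℝ) ≤ d := by exact_mod_cast hd1
    push_cast at h
    linarith
end
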